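/- Assume Condition (C) holds and ρ_k = 1 + 3r_k + O(r_k²) as k → ∞. Then: if β > 1, almost surely Y has at most finitely many cutpoints; if β ≤ 1, almost surely Y has infinitely many cutpoints. -/

import Mathlib

open Filter MeasureTheory ENNReal Topology Asymptotics

noncomputable section

/-- Transition function of the (1,2) random walk `Y`. -/
def transY (q p1 p2 : ℕ → ℝ) (n j : ℕ) : ℝ :=
  if n = 0 then (if j = 2 then 1 else 0)
  else if n = 1 then (if j = 0 then 1 else 0)
  else if j = n - 1 then q n
  else if j = n + 1 then p1 n
  else if j = n + 2 then p2 n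
  else 0

/-- `μ` is the law (on path space) of the time-homogeneous Markov chain on `ℕ`
with one-step transition probabilities `p` and initial state `init`. -/
def IsMarkovChain (μ : Measure (ℕ → ℕ)) (p : ℕ → ℕ → ℝ) (init : ℕ) : Prop :=
  μ {ω | ω 0 = init} = 1 ∧
  ∀ (k : ℕ) (x : ℕ → ℕ) (j : ℕ),
    μ {ω | (∀ i ≤ k, ω i = x i) ∧ ω (k + 1) = j}
      = ENNReal.ofReal (p (x k) j) * μ {ω | ∀ i ≤ k, ω i = x i}

/-- `ρ_k`, the spectral radius of the matrix `A_k`. -/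
def rho (q p1 p2 : ℕ → ℝ) (k : ℕ) : ℝ :=
  ((p1 k + p2 k) / q k
    + Real.sqrt (((p1 k + p2 k) / q k) ^ 2 + 4 * (p2 k / q k))) / 2

/-- The perturbation `r_n = (1/3)(1/n + 1/(n (log log n)^β))` for `n ≥ 4`,
and `r_2 = r_3 = r_4`. -/
def rseq (β : ℝ) (n : ℕ) : ℝ :=
  if 4 ≤ n then
    (1 / 3) * (1 / (n : ℝ) + 1 / ((n : ℝ) * Real.log (Real.log (n : ℝ)) ^ β))
  else
    (1 / 3) * (1 / (4 : ℝ) + 1 / ((4 : ℝ) * Real.log (Real.log (4 : ℝ)) ^ β))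

section

/-- `A` is determined by the first `n + 1` coordinates. -/
def DetBy (n : ℕ) (A : Set (ℕ → ℕ)) : Prop :=
  ∀ ω ω' : ℕ → ℕ, (∀ i ≤ n, ω i = ω' i) → ω ∈ A → ω' ∈ A

/-- shift of the path by `n`. -/
def shiftP (n : ℕ) (ω : ℕ → ℕ) : ℕ → ℕ := fun i => ω (n + i)

lemma measurable_shiftP (n : ℕ) : Measurable (shiftP n) := by
  unfold shiftP
  fun_prop

lemma measurableSet_eqAt (n i : ℕ) : MeasurableSet {ω : ℕ → ℕ | ω n = i} :=
  (measurable_pi_apply (X := fun _ : ℕ => ℕ) n) (measurableSet_singleton i)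

lemma measurableSet_memAt (n : ℕ) (S : Set ℕ) : MeasurableSet {ω : ℕ → ℕ | ω n ∈ S} :=
  (measurable_pi_apply n) (MeasurableSet.of_discrete (s := S))

/-- restriction to first coordinates -/
def restrP (n : ℕ) (ω : ℕ → ℕ) : Fin (n + 1) → ℕ := fun i => ω i

lemma measurable_restrP (n : ℕ) : Measurable (restrP n) := by
  unfold restrP
  fun_prop

lemma measure_eq_tsum_restrP (μ : Measure (ℕ → ℕ)) (n : ℕ) (E : Set (ℕ → ℕ))
    (hE : MeasurableSet E) :
    μ E = ∑' y : Fin (n + 1) → ℕ, μ (E ∩ restrP n ⁻¹' {y}) := by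
  rw [← measure_iUnion]
  · congr 1
    ext ω
    simp
  · intro y z hyz
    refine Set.disjoint_left.2 ?_
    rintro ω ⟨_, h1⟩ ⟨_, h2⟩
    exact hyz (by simp at h1 h2; rw [← h1, ← h2])
  · intro y
    exact hE.inter (measurable_restrP n (measurableSet_singleton y))

lemma markov_step {μ : Measure (ℕ → ℕ)} {p : ℕ → ℕ → ℝ} {x : ℕ} (hμ : IsMarkovChain μ p x)
    {n : ℕ} {A : Set (ℕ → ℕ)} (hA : MeasurableSet A) (hd : DetBy n A) (i j : ℕ) 
    (hi : ∀ ω ∈ A, ω n = i) :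
    μ (A ∩ {ω | ω (n + 1) = j}) = ENNReal.ofReal (p i j) * μ A := by
  rw [measure_eq_tsum_restrP μ n A hA, measure_eq_tsum_restrP μ n _ (hA.inter (measurableSet_eqAt _ _)),
    ← ENNReal.tsum_mul_left]
  refine tsum_congr fun y => ?_
  by_cases h : ∃ ω ∈ A, restrP n ω = y
  · obtain ⟨ω, hω, rfl⟩ := h
    have key : ∀ ω' : ℕ → ℕ, restrP n ω' = restrP n ω ↔ ∀ i ≤ n, ω' i = ω i := by
      intro ω'
      constructor
      · intro h i hi
        exact congrFun h ⟨i, by omega⟩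
      · intro h
        funext i
        exact h i (by omega)
    have h1 : A ∩ restrP n ⁻¹' {restrP n ω} = {ω' | ∀ i ≤ n, ω' i = ω i} := by
      ext ω'
      simp only [Set.mem_inter_iff, Set.mem_preimage, Set.mem_singleton_iff, key, Set.mem_ofPred_eq]
      exact ⟨fun h => h.2, fun h => ⟨hd ω ω' (fun i hi => (h i hi).symm) hω, h⟩⟩
    have h2 : A ∩ {ω | ω (n + 1) = j} ∩ restrP n ⁻¹' {restrP n ω} 
        = {ω' | (∀ i ≤ n, ω' i = ω i) ∧ ω' (n + 1) = j} := by
      rw [Set.inter_right_comm, h1]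
      rfl
    rw [h1, h2, hμ.2 n ω j, hi ω hω]
  · have h1 : A ∩ restrP n ⁻¹' {y} = ∅ := by
      ext ω
      simp only [Set.mem_inter_iff, Set.mem_preimage, Set.mem_singleton_iff, Set.mem_empty_iff_false,
        iff_false]
      exact fun h' => h ⟨ω, h'⟩
    rw [Set.inter_right_comm, h1]
    simp

/-- restarting the chain. -/
lemma markov_restart {μ : Measure (ℕ → ℕ)} [IsProbabilityMeasure μ] {p : ℕ → ℕ → ℝ} {x : ℕ}
    (hμ : IsMarkovChain μ p x)
    {n : ℕ} {A : Set (ℕ → ℕ)} (hA : MeasurableSet A) (hd : DetBy n A) (i : ℕ) 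
    (hi : ∀ ω ∈ A, ω n = i) (h0 : μ A ≠ 0) :
    ∃ ν : Measure (ℕ → ℕ), IsProbabilityMeasure ν ∧ IsMarkovChain ν p i ∧
      ∀ B, MeasurableSet B → μ (A ∩ shiftP n ⁻¹' B) = μ A * ν B := by
  have hfin : μ A ≠ ∞ := measure_ne_top μ A
  have hB : ∀ B, MeasurableSet B → 
      ((ProbabilityTheory.cond μ A).map (shiftP n)) B = (μ A)⁻¹ * μ (A ∩ shiftP n ⁻¹' B) := by
    intro B hB
    rw [Measure.map_apply (measurable_shiftP n) hB, ProbabilityTheory.cond_apply hA]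
  have : IsProbabilityMeasure (ProbabilityTheory.cond μ A) := ProbabilityTheory.cond_isProbabilityMeasure h0
  refine ⟨(ProbabilityTheory.cond μ A).map (shiftP n), 
    Measure.isProbabilityMeasure_map (measurable_shiftP n).aemeasurable, ⟨?_, ?_⟩, ?_⟩
  · rw [hB _ (measurableSet_eqAt _ _)]
    have : A ∩ shiftP n ⁻¹' {ω | ω 0 = i} = A := by
      ext ω
      simp only [Set.mem_inter_iff, Set.mem_preimage, Set.mem_ofPred_eq, shiftP, add_zero]
      exact ⟨fun h => h.1, fun h => ⟨h, hi ω h⟩⟩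
    rw [this, ENNReal.inv_mul_cancel h0 hfin]
  · intro k z j
    have hm : MeasurableSet {ω : ℕ → ℕ | ∀ i ≤ k, ω i = z i} := by
      simp only [Set.ofPred_forall]
      exact MeasurableSet.iInter fun i => MeasurableSet.iInter fun _ => measurableSet_eqAt _ _
    have hm2 : MeasurableSet {ω : ℕ → ℕ | (∀ i ≤ k, ω i = z i) ∧ ω (k + 1) = j} :=
      hm.inter (measurableSet_eqAt _ _)
    rw [hB _ hm, hB _ hm2]
    have h1 := markov_step hμ (n := n + k) (A := A ∩ shiftP n ⁻¹' {ω : ℕ → ℕ | ∀ i ≤ k, ω i = z i})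
      (hA.inter (measurable_shiftP n hm)) (by
        rintro ω ω' h ⟨h1, h2⟩
        refine ⟨hd ω ω' (fun i hi => h i (by omega)) h1, ?_⟩
        intro l hl
        rw [← h2 l hl]
        exact (h (n + l) (by omega)).symm) (z k) j (by
        rintro ω ⟨_, h2⟩
        exact h2 k le_rfl)
    have h2 : A ∩ shiftP n ⁻¹' {ω : ℕ → ℕ | (∀ i ≤ k, ω i = z i) ∧ ω (k + 1) = j}
      = A ∩ shiftP n ⁻¹' {ω : ℕ → ℕ | ∀ i ≤ k, ω i = z i} ∩ {ω | ω (n + k + 1) = j} := by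
      rw [Set.inter_assoc]
      rfl
    rw [h2, h1]
    ring
  · intro B hBm
    rw [hB B hBm, ← mul_assoc, ENNReal.mul_inv_cancel h0 hfin, one_mul]

lemma markov_restart_le {μ : Measure (ℕ → ℕ)} [IsProbabilityMeasure μ] {p : ℕ → ℕ → ℝ} {x : ℕ}
    (hμ : IsMarkovChain μ p x)
    {n : ℕ} {A : Set (ℕ → ℕ)} (hA : MeasurableSet A) (hd : DetBy n A) (i : ℕ) 
    (hi : ∀ ω ∈ A, ω n = i) {B : Set (ℕ → ℕ)} (hB : MeasurableSet B) (c : ℝ≥0∞)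
    (h : ∀ ν : Measure (ℕ → ℕ), IsProbabilityMeasure ν → IsMarkovChain ν p i → ν B ≤ c) :
    μ (A ∩ shiftP n ⁻¹' B) ≤ c * μ A := by
  by_cases h0 : μ A = 0
  · rw [measure_mono_null Set.inter_subset_left h0]
    exact zero_le
  · obtain ⟨ν, h1, h2, h3⟩ := markov_restart hμ hA hd i hi h0
    rw [h3 B hB, mul_comm]
    gcongr
    exact h ν h1 h2

lemma markov_restart_ge {μ : Measure (ℕ → ℕ)} [IsProbabilityMeasure μ] {p : ℕ → ℕ → ℝ} {x : ℕ}
    (hμ : IsMarkovChain μ p x)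
    {n : ℕ} {A : Set (ℕ → ℕ)} (hA : MeasurableSet A) (hd : DetBy n A) (i : ℕ) 
    (hi : ∀ ω ∈ A, ω n = i) {B : Set (ℕ → ℕ)} (hB : MeasurableSet B) (c : ℝ≥0∞)
    (h : ∀ ν : Measure (ℕ → ℕ), IsProbabilityMeasure ν → IsMarkovChain ν p i → c ≤ ν B) :
    c * μ A ≤ μ (A ∩ shiftP n ⁻¹' B) := by
  by_cases h0 : μ A = 0
  · simp [h0]
  · obtain ⟨ν, h1, h2, h3⟩ := markov_restart hμ hA hd i hi h0
    rw [h3 B hB, mul_comm]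
    gcongr
    exact h ν h1 h2

/-- first exit of `S` at time `n`, at the point `i` (or, when `i ∈ S`, still inside). -/
def EntS (S : Set ℕ) (n i : ℕ) : Set (ℕ → ℕ) := {ω | (∀ m < n, ω m ∈ S) ∧ ω n = i}

lemma measurableSet_EntS (S : Set ℕ) (n i : ℕ) : MeasurableSet (EntS S n i) := by
  have : MeasurableSet {ω : ℕ → ℕ | ∀ m < n, ω m ∈ S} := by
    simp only [Set.ofPred_forall]
    exact MeasurableSet.iInter fun i => MeasurableSet.iInter fun _ => measurableSet_memAt _ _
  exact this.inter (measurableSet_eqAt n i)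

lemma detBy_EntS (S : Set ℕ) (n i : ℕ) : DetBy n (EntS S n i) := by
  rintro ω ω' h ⟨h1, h2⟩
  exact ⟨fun m hm => h m hm.le ▸ h1 m hm, h n le_rfl ▸ h2⟩

open Classical in
/-- mass of the chain killed outside `S`. -/
def mm (p : ℕ → ℕ → ℝ) (S : Set ℕ) (x : ℕ) : ℕ → ℕ → ℝ≥0∞
  | 0, i => if i = x then 1 else 0
  | n + 1, j => ∑' i, (if i ∈ S then mm p S x n i * ENNReal.ofReal (p i j) else 0)

lemma measure_EntS {μ : Measure (ℕ → ℕ)} [IsProbabilityMeasure μ] {p : ℕ → ℕ → ℝ} {x : ℕ} 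
    (hμ : IsMarkovChain μ p x) (S : Set ℕ) (n i : ℕ) : μ (EntS S n i) = mm p S x n i := by
  classical
  induction n generalizing i with
  | zero =>
    have h0 : EntS S 0 i = {ω | ω 0 = i} := by
      ext ω; simp [EntS]
    rw [h0, mm]
    split_ifs with h
    · rw [h, hμ.1]
    · refine measure_mono_null (t := {ω | ω 0 = x}ᶜ) ?_ ?_
      · intro ω hω hω'
        exact h (hω.symm.trans hω')
      · rw [prob_compl_eq_zero_iff (measurableSet_eqAt _ _)]
        exact hμ.1
  | succ n ih =>
    rw [mm]
    have h1 : EntS S (n + 1) i = ⋃ l, (if l ∈ S then EntS S n l ∩ {ω | ω (n + 1) = i} else ∅) := by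
      ext ω
      simp only [EntS, Set.mem_iUnion, Set.mem_ofPred_eq]
      constructor
      · rintro ⟨h1, h2⟩
        refine ⟨ω n, ?_⟩
        rw [if_pos (h1 n (by omega))]
        exact ⟨⟨fun m hm => h1 m (by omega), rfl⟩, h2⟩
      · rintro ⟨l, hl⟩
        split_ifs at hl with h
        · obtain ⟨⟨h1, h2⟩, h3⟩ := hl
          refine ⟨fun m hm => ?_, h3⟩
          rcases Nat.lt_succ_iff_lt_or_eq.1 hm with h' | h'
          · exact h1 m h'
          · rw [h', h2]; exact h
        · exact hl.elim
    rw [h1, measure_iUnion]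
    · refine tsum_congr fun l => ?_
      split_ifs with h
      · rw [markov_step hμ (measurableSet_EntS S n l) (detBy_EntS S n l) l i (fun ω hω => hω.2), ih,
          mul_comm]
      · simp
    · intro l l' hl
      refine Set.disjoint_left.2 ?_
      intro ω h1 h2
      beta_reduce at h1 h2
      split_ifs at h1 h2
      · exact hl (h1.1.2.symm.trans h2.1.2)
      all_goals simp_all
    · intro l
      split_ifs
      · exact (measurableSet_EntS S n l).inter (measurableSet_eqAt _ _)
      · exact MeasurableSet.empty

open Classical in
lemma mm_super {p : ℕ → ℕ → ℝ} {S : Set ℕ} (x : ℕ) (h : ℕ → ℝ≥0∞)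
    (hh : ∀ i ∈ S, ∑' j, ENNReal.ofReal (p i j) * h j ≤ h i) (N : ℕ) :
    ∑ n ∈ Finset.range N, ∑' i, (if i ∈ S then 0 else mm p S x n i * h i)
      + ∑' i, mm p S x N i * h i ≤ h x := by
  induction N with
  | zero => simp [mm]
  | succ N ih =>
    refine le_trans ?_ ih
    rw [Finset.sum_range_succ, add_assoc]
    gcongr
    have h1 : ∑' j, mm p S x (N + 1) j * h j 
        = ∑' i, if i ∈ S then mm p S x N i * ∑' j, ENNReal.ofReal (p i j) * h j else 0 := by
      simp only [mm, ← ENNReal.tsum_mul_right]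
      rw [ENNReal.tsum_comm]
      refine tsum_congr fun i => ?_
      split_ifs
      · rw [← ENNReal.tsum_mul_left]
        refine tsum_congr fun j => ?_
        ring
      · simp
    rw [h1, ← ENNReal.tsum_add]
    refine ENNReal.tsum_le_tsum fun i => ?_
    split_ifs with hi
    · rw [zero_add]
      gcongr
      exact hh i hi
    · simp

open Classical in
lemma mm_sub {p : ℕ → ℕ → ℝ} {S : Set ℕ} (x : ℕ) (h : ℕ → ℝ≥0∞)
    (hh : ∀ i ∈ S, h i ≤ ∑' j, ENNReal.ofReal (p i j) * h j) (N : ℕ) :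
    h x ≤ ∑ n ∈ Finset.range N, ∑' i, (if i ∈ S then 0 else mm p S x n i * h i)
      + ∑' i, mm p S x N i * h i := by
  induction N with
  | zero => simp [mm]
  | succ N ih =>
    refine le_trans ih ?_
    rw [Finset.sum_range_succ, add_assoc]
    gcongr
    have h1 : ∑' j, mm p S x (N + 1) j * h j 
        = ∑' i, if i ∈ S then mm p S x N i * ∑' j, ENNReal.ofReal (p i j) * h j else 0 := by
      simp only [mm, ← ENNReal.tsum_mul_right]
      rw [ENNReal.tsum_comm]
      refine tsum_congr fun i => ?_
      split_ifs
      · rw [← ENNReal.tsum_mul_left]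
        refine tsum_congr fun j => ?_
        ring
      · simp
    rw [h1, ← ENNReal.tsum_add]
    refine ENNReal.tsum_le_tsum fun i => ?_
    split_ifs with hi
    · rw [zero_add]
      gcongr
      exact hh i hi
    · simp

lemma ae_legal {μ : Measure (ℕ → ℕ)} [IsProbabilityMeasure μ] {p : ℕ → ℕ → ℝ} {x : ℕ} 
    (hμ : IsMarkovChain μ p x) : ∀ᵐ ω ∂μ, ω 0 = x ∧ ∀ n, 0 < p (ω n) (ω (n + 1)) := by
  have h0 : ∀ᵐ ω ∂μ, ω 0 = x := by
    rw [ae_iff]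
    have := (prob_compl_eq_zero_iff (μ := μ) (measurableSet_eqAt 0 x)).2 hμ.1
    exact this
  have h1 : ∀ᵐ ω ∂μ, ∀ n i j, ¬ (ω n = i ∧ ω (n + 1) = j ∧ ¬ 0 < p i j) := by
    rw [ae_all_iff]; intro n
    rw [ae_all_iff]; intro i
    rw [ae_all_iff]; intro j
    by_cases hp : 0 < p i j
    · exact Filter.Eventually.of_forall (by tauto)
    · rw [ae_iff]
      have := markov_step hμ (measurableSet_eqAt n i) (n := n) (by
        intro ω ω' h h'
        exact (h n le_rfl).symm.trans h') i j (fun ω h => h)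
      rw [ENNReal.ofReal_of_nonpos (not_lt.1 hp), zero_mul] at this
      refine measure_mono_null ?_ this
      intro ω hω
      simp only [Set.mem_ofPred_eq, not_not] at hω
      exact ⟨hω.1, hω.2.1⟩
  filter_upwards [h0, h1] with ω h0 h1
  refine ⟨h0, fun n => ?_⟩
  by_contra h
  exact h1 n _ _ ⟨rfl, rfl, h⟩


end

section

/-- Standing assumptions on transition probabilities. -/
structure WalkHyp (q p1 p2 : ℕ → ℝ) : Prop where
  hq : ∀ k, 2 ≤ k → 0 < q k
  hp1 : ∀ k, 2 ≤ k → 0 ≤ p1 k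
  hp2 : ∀ k, 2 ≤ k → 0 < p2 k
  hsum : ∀ k, 2 ≤ k → q k + p1 k + p2 k = 1

variable {q p1 p2 : ℕ → ℝ}

lemma transY_legal {i j : ℕ} (h : 0 < transY q p1 p2 i j) :
    (i = 0 ∧ j = 2) ∨ (i = 1 ∧ j = 0) ∨ (2 ≤ i ∧ (j + 1 = i ∨ j = i + 1 ∨ j = i + 2)) := by
  unfold transY at h
  split_ifs at h <;> first | omega | (exfalso; exact lt_irrefl _ h)

lemma tsum_trans (i : ℕ) (hi : 2 ≤ i) (h : ℕ → ℝ≥0∞) :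
    ∑' j, ENNReal.ofReal (transY q p1 p2 i j) * h j
      = ENNReal.ofReal (q i) * h (i - 1) + ENNReal.ofReal (p1 i) * h (i + 1)
        + ENNReal.ofReal (p2 i) * h (i + 2) := by
  have e0 : transY q p1 p2 i (i - 1) = q i := by
    unfold transY; split_ifs <;> first | omega | rfl
  have e1 : transY q p1 p2 i (i + 1) = p1 i := by
    unfold transY; split_ifs <;> first | omega | rfl
  have e2 : transY q p1 p2 i (i + 2) = p2 i := by
    unfold transY; split_ifs <;> first | omega | rfl
  rw [tsum_eq_sum (s := {i - 1, i + 1, i + 2})]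
  · rw [Finset.sum_insert, Finset.sum_insert, Finset.sum_singleton, e0, e1, e2, add_assoc]
    · simp
    · simp; omega
  · intro j hj
    simp only [Finset.mem_insert, Finset.mem_singleton, not_or] at hj
    have : transY q p1 p2 i j = 0 := by
      unfold transY; split_ifs <;> first | omega | rfl
    simp [this]

lemma tsum_trans0 (h : ℕ → ℝ≥0∞) :
    ∑' j, ENNReal.ofReal (transY q p1 p2 0 j) * h j = h 2 := by
  rw [tsum_eq_single 2]
  · simp [transY]
  · intro j hj
    simp [transY, hj]

lemma tsum_trans1 (h : ℕ → ℝ≥0∞) :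
    ∑' j, ENNReal.ofReal (transY q p1 p2 1 j) * h j = h 0 := by
  rw [tsum_eq_single 0]
  · simp [transY]
  · intro j hj
    simp [transY, hj]

lemma WalkHyp.row (H : WalkHyp q p1 p2) (i : ℕ) :
    ∑' j, ENNReal.ofReal (transY q p1 p2 i j) = 1 := by
  have h1 : ∑' j, ENNReal.ofReal (transY q p1 p2 i j) 
    = ∑' j, ENNReal.ofReal (transY q p1 p2 i j) * (fun _ => 1) j := by simp
  rw [h1]
  by_cases h0 : i = 0
  · rw [h0, tsum_trans0]
  by_cases h1 : i = 1
  · rw [h1, tsum_trans1]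
  have hi : 2 ≤ i := by omega
  rw [tsum_trans i hi]
  have a1 := H.hq i hi
  have a2 := H.hp1 i hi
  have a3 := H.hp2 i hi
  simp only [mul_one]
  rw [← ENNReal.ofReal_add a1.le a2, ← ENNReal.ofReal_add (by positivity) a3.le, H.hsum i hi]
  simp

open Classical in
lemma mm_total (H : WalkHyp q p1 p2) (S : Set ℕ) (x N : ℕ) :
    ∑ n ∈ Finset.range N, ∑' i, (if i ∈ S then 0 else mm (transY q p1 p2) S x n i)
      + ∑' i, mm (transY q p1 p2) S x N i = 1 := by
  have h1 := mm_super (p := transY q p1 p2) (S := S) x (fun _ => 1) (by simp [H.row]) N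
  have h2 := mm_sub (p := transY q p1 p2) (S := S) x (fun _ => 1) (by simp [H.row]) N
  simp only [mul_one] at h1 h2
  exact le_antisymm h1 h2

/-- total occupation / exit mass. -/
def MM (p : ℕ → ℕ → ℝ) (S : Set ℕ) (x i : ℕ) : ℝ≥0∞ := ∑' n, mm p S x n i

open Classical in
lemma exit_super {p : ℕ → ℕ → ℝ} {S : Set ℕ} (x : ℕ) (h : ℕ → ℝ≥0∞)
    (hh : ∀ i ∈ S, ∑' j, ENNReal.ofReal (p i j) * h j ≤ h i) :
    ∑' i, (if i ∈ S then 0 else MM p S x i * h i) ≤ h x := by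
  have : ∑' i, (if i ∈ S then 0 else MM p S x i * h i)
      = ∑' n, ∑' i, (if i ∈ S then 0 else mm p S x n i * h i) := by
    rw [ENNReal.tsum_comm]
    refine tsum_congr fun i => ?_
    split_ifs
    · simp
    · rw [MM, ENNReal.tsum_mul_right]
  rw [this]
  refine ENNReal.tsum_le_of_sum_range_le fun N => ?_
  exact le_trans le_self_add (mm_super x h hh N)

lemma MM_le_one (H : WalkHyp q p1 p2) (S : Set ℕ) (x i : ℕ) (hi : i ∉ S) :
    MM (transY q p1 p2) S x i ≤ 1 := by
  classical
  have h1 := exit_super (p := transY q p1 p2) (S := S) x (fun _ => 1) (by simp [H.row])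
  refine le_trans ?_ h1
  refine le_trans ?_ (ENNReal.le_tsum i)
  simp [hi]

lemma MM_step {p : ℕ → ℕ → ℝ} {S : Set ℕ} (x : ℕ) {l : ℕ} (hl : l ∈ S) (j : ℕ) :
    MM p S x l * ENNReal.ofReal (p l j) ≤ MM p S x j := by
  classical
  rw [MM, MM, ← ENNReal.tsum_mul_right]
  rw [tsum_eq_zero_add' (f := fun n => mm p S x n j) ENNReal.summable]
  refine le_trans ?_ le_add_self
  refine ENNReal.tsum_le_tsum fun n => ?_
  rw [mm]
  refine le_trans ?_ (ENNReal.le_tsum l)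
  simp [hl]

lemma MM_lt_top (H : WalkHyp q p1 p2) {S : Set ℕ} {k : ℕ} (hk : ∀ i ∈ S, i < k) (x l : ℕ) :
    MM (transY q p1 p2) S x l < ∞ := by
  have big : ∀ m, ∀ l, 2 ≤ l → k ≤ l + m → MM (transY q p1 p2) S x l < ∞ := by
    intro m
    induction m using Nat.strong_induction_on with
    | _ m ih =>
      intro l hl hm
      by_cases hS : l ∈ S
      · have h1 := hk l hS
        have h2 : MM (transY q p1 p2) S x (l + 2) < ∞ := ih (m - 2) (by omega) _ (by omega) (by omega)
        have h3 := MM_step (p := transY q p1 p2) x hS (l + 2)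
        have e2 : transY q p1 p2 l (l + 2) = p2 l := by
          unfold transY; split_ifs <;> first | omega | rfl
        rw [e2] at h3
        have h4 : ENNReal.ofReal (p2 l) ≠ 0 := by
          simpa using H.hp2 l hl
        by_contra hcon
        rw [not_lt, top_le_iff] at hcon
        rw [hcon, ENNReal.top_mul h4] at h3
        exact absurd h2 (not_lt.2 h3)
      · exact lt_of_le_of_lt (MM_le_one H S x l hS) ENNReal.one_lt_top
  have z : MM (transY q p1 p2) S x 0 < ∞ := by
    by_cases hS : 0 ∈ S
    · have h3 := MM_step (p := transY q p1 p2) x hS 2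
      have e2 : transY q p1 p2 0 2 = 1 := by simp [transY]
      rw [e2] at h3
      simp only [ENNReal.ofReal_one, mul_one] at h3
      exact lt_of_le_of_lt h3 (big k 2 (by omega) (by omega))
    · exact lt_of_le_of_lt (MM_le_one H S x _ hS) ENNReal.one_lt_top
  by_cases h0 : l = 0
  · rw [h0]; exact z
  by_cases h1 : l = 1
  · rw [h1]
    by_cases hS : 1 ∈ S
    · have h3 := MM_step (p := transY q p1 p2) x hS 0
      have e2 : transY q p1 p2 1 0 = 1 := by simp [transY]
      rw [e2] at h3
      simp only [ENNReal.ofReal_one, mul_one] at h3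
      exact lt_of_le_of_lt h3 z
    · exact lt_of_le_of_lt (MM_le_one H S x _ hS) ENNReal.one_lt_top
  exact big k l (by omega) (by omega)

lemma transY_far {i j : ℕ} (h : i + 2 < j) : transY q p1 p2 i j = 0 := by
  unfold transY; split_ifs <;> first | omega | rfl

lemma mm_support {S : Set ℕ} {k : ℕ} (hk : ∀ i ∈ S, i < k) {x : ℕ} (hx : x < k) (n i : ℕ) 
    (hi : k + 1 < i) : mm (transY q p1 p2) S x n i = 0 := by
  classical
  cases n with
  | zero => rw [mm, if_neg]; omega
  | succ n =>
    rw [mm, ENNReal.tsum_eq_zero]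
    intro l
    split_ifs with h
    · have := hk l h
      rw [transY_far (by omega)]; simp
    · rfl

/-- the mass tends to zero -/
lemma mm_tendsto (H : WalkHyp q p1 p2) {S : Set ℕ} {k : ℕ} (hk : ∀ i ∈ S, i < k) {x : ℕ}
    (hx : x < k) :
    Tendsto (fun N => ∑' i, mm (transY q p1 p2) S x N i) atTop (𝓝 0) := by
  have h1 : (fun N => ∑' i, mm (transY q p1 p2) S x N i) 
    = fun N => ∑ i ∈ Finset.range (k + 2), mm (transY q p1 p2) S x N i := by
    funext N
    refine tsum_eq_sum fun i hi => ?_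
    rw [Finset.mem_range] at hi
    exact mm_support hk hx N i (by omega)
  rw [h1]
  have : (0 : ℝ≥0∞) = ∑ i ∈ Finset.range (k + 2), 0 := by simp
  rw [this]
  refine tendsto_finsetSum _ fun i _ => ?_
  exact ENNReal.tendsto_atTop_zero_of_tsum_ne_top (MM_lt_top H hk x i).ne

open Classical in
lemma exit_sub (H : WalkHyp q p1 p2) {S : Set ℕ} {k : ℕ} (hk : ∀ i ∈ S, i < k) {x : ℕ}
    (hx : x < k) (h : ℕ → ℝ≥0∞) (B : ℝ≥0∞) (hB : B ≠ ∞) (hhB : ∀ i, h i ≤ B)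
    (hh : ∀ i ∈ S, h i ≤ ∑' j, ENNReal.ofReal (transY q p1 p2 i j) * h j) :
    h x ≤ ∑' i, (if i ∈ S then 0 else MM (transY q p1 p2) S x i * h i) := by
  have : ∑' i, (if i ∈ S then 0 else MM (transY q p1 p2) S x i * h i)
      = ∑' n, ∑' i, (if i ∈ S then 0 else mm (transY q p1 p2) S x n i * h i) := by
    rw [ENNReal.tsum_comm]
    refine tsum_congr fun i => ?_
    split_ifs
    · simp
    · rw [MM, ENNReal.tsum_mul_right]
  rw [this]
  have h1 : ∀ N, h x ≤ ∑' n, ∑' i, (if i ∈ S then 0 else mm (transY q p1 p2) S x n i * h i)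
      + (∑' i, mm (transY q p1 p2) S x N i) * B := by
    intro N
    refine le_trans (mm_sub x h hh N) ?_
    gcongr
    · exact ENNReal.sum_le_tsum _
    · rw [← ENNReal.tsum_mul_right]
      refine ENNReal.tsum_le_tsum fun i => ?_
      gcongr
      exact hhB i
  have h2 := (ENNReal.Tendsto.mul_const (mm_tendsto H hk hx) (b := B) (Or.inr hB)).const_add
    (∑' n, ∑' i, (if i ∈ S then 0 else mm (transY q p1 p2) S x n i * h i))
  rw [zero_mul, add_zero] at h2
  exact ge_of_tendsto' h2 h1

lemma MM_exit_compare (H : WalkHyp q p1 p2) {c : ℝ} (hc : 0 < c) {K : ℕ} (hK : 2 ≤ K)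
    (hcq : ∀ n, K ≤ n → c ≤ q n) (hcp : ∀ n, K ≤ n → c ≤ p2 n)
    {S : Set ℕ} {k : ℕ} (hk : ∀ i ∈ S, i < k) {x : ℕ} (hx : x < k) (hkK : K + 3 ≤ k)
    (h1 : k - 1 ∈ S) (h2 : k - 2 ∈ S) (h3 : k - 3 ∈ S) :
    ENNReal.ofReal (c ^ 3 / 3) * (MM (transY q p1 p2) S x k + MM (transY q p1 p2) S x (k + 1))
      ≤ MM (transY q p1 p2) S x (k + 1) := by
  classical
  set c' := ENNReal.ofReal c with hc'
  set M := MM (transY q p1 p2) S x with hM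
  have c1 : c ≤ 1 := by
    have := hcq K le_rfl
    have a2 := H.hp1 K hK
    have a3 := H.hp2 K hK
    have a4 := H.hsum K hK
    linarith
  have c'1 : c' ≤ 1 := by
    rw [hc', ← ENNReal.ofReal_one]; exact ENNReal.ofReal_le_ofReal c1
  have A : c' * M (k - 1) ≤ M (k + 1) := by
    refine le_trans ?_ (MM_step x h1 (k + 1))
    rw [mul_comm]
    have e2 : transY q p1 p2 (k - 1) (k + 1) = p2 (k - 1) := by
      unfold transY; split_ifs <;> first | omega | rfl
    rw [e2]
    gcongr
    exact ENNReal.ofReal_le_ofReal (hcp _ (by omega))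
  have B : c' * M (k - 3) ≤ M (k - 1) := by
    refine le_trans ?_ (MM_step x h3 (k - 1))
    rw [mul_comm]
    have e2 : transY q p1 p2 (k - 3) (k - 1) = p2 (k - 3) := by
      unfold transY; split_ifs <;> first | omega | rfl
    rw [e2]
    gcongr
    exact ENNReal.ofReal_le_ofReal (hcp _ (by omega))
  have C : c' * M (k - 2) ≤ M (k - 3) := by
    refine le_trans ?_ (MM_step x h2 (k - 3))
    rw [mul_comm]
    have e2 : transY q p1 p2 (k - 2) (k - 3) = q (k - 2) := by
      unfold transY; split_ifs <;> first | omega | rfl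
    rw [e2]
    gcongr
    exact ENNReal.ofReal_le_ofReal (hcq _ (by omega))
  have D : M k ≤ M (k - 1) + M (k - 2) := by
    rw [hM, MM, MM, MM, ← ENNReal.tsum_add]
    rw [tsum_eq_zero_add' ENNReal.summable]
    have z : mm (transY q p1 p2) S x 0 k = 0 := by
      rw [mm, if_neg]; omega
    rw [z, zero_add]
    refine ENNReal.tsum_le_tsum fun n => ?_
    rw [mm, tsum_eq_sum (s := {k - 1, k - 2})]
    · rw [Finset.sum_pair (by omega), if_pos h1, if_pos h2]
      have b1 : ∀ i j, ENNReal.ofReal (transY q p1 p2 i j) ≤ 1 := by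
        intro i j
        rw [← H.row i]
        exact ENNReal.le_tsum j
      gcongr
      · exact mul_le_of_le_one_right' (b1 _ _)
      · exact mul_le_of_le_one_right' (b1 _ _)
    · intro l hl
      simp only [Finset.mem_insert, Finset.mem_singleton, not_or] at hl
      split_ifs with h
      · have := hk l h
        rw [transY_far (by omega)]; simp
      · rfl
  have e3 : ENNReal.ofReal (c ^ 3 / 3) * 3 = c' ^ 3 := by
    rw [hc', ← ENNReal.ofReal_pow hc.le]
    have : (3 : ℝ≥0∞) = ENNReal.ofReal 3 := by simp
    rw [this, ← ENNReal.ofReal_mul (by positivity)]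
    congr 1; ring
  have E1 : c' ^ 3 * M (k - 1) ≤ M (k + 1) := by
    calc c' ^ 3 * M (k - 1) = c' * c' * (c' * M (k - 1)) := by ring
      _ ≤ 1 * 1 * M (k + 1) := by gcongr
      _ = _ := by ring
  have E2 : c' ^ 3 * M (k - 2) ≤ M (k + 1) := by
    calc c' ^ 3 * M (k - 2) = c' * (c' * (c' * M (k - 2))) := by ring
      _ ≤ c' * (c' * M (k - 3)) := by gcongr
      _ ≤ c' * M (k - 1) := by gcongr
      _ ≤ M (k + 1) := A
  have E3 : c' ^ 3 * M (k + 1) ≤ M (k + 1) := by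
    calc c' ^ 3 * M (k + 1) ≤ 1 ^ 3 * M (k + 1) := by gcongr
      _ = _ := by ring
  have E : c' ^ 3 * (M k + M (k + 1)) ≤ 3 * M (k + 1) := by
    calc c' ^ 3 * (M k + M (k + 1)) ≤ c' ^ 3 * ((M (k - 1) + M (k - 2)) + M (k + 1)) := by gcongr
      _ = c' ^ 3 * M (k - 1) + c' ^ 3 * M (k - 2) + c' ^ 3 * M (k + 1) := by ring
      _ ≤ M (k + 1) + M (k + 1) + M (k + 1) := by gcongr
      _ = _ := by ring
  rw [← e3, mul_right_comm, mul_comm, ] at E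
  exact (ENNReal.mul_le_mul_iff_right (by simp) (by simp)).1 E


end

section

variable {q p1 p2 : ℕ → ℝ}

/-- the harmonic increments and constants. -/
structure HarmHyp (q p1 p2 d : ℕ → ℝ) (K : ℕ) (c : ℝ) : Prop where
  hK : 2 ≤ K
  c0 : 0 < c
  cq : ∀ n, K ≤ n → c ≤ q n
  cp : ∀ n, K ≤ n → c ≤ p2 n
  dpos : ∀ n, K ≤ n → 0 < d n
  dsum : Summable d
  harm : ∀ n, K < n → q n * d (n - 1) = (p1 n + p2 n) * d n + p2 n * d (n + 1)

/-- partial sums of increments -/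
def HH (d : ℕ → ℝ) (j m : ℕ) : ℝ := ∑ l ∈ Finset.Ico j m, d l

/-- tail sums -/
def TT (d : ℕ → ℝ) (k : ℕ) : ℝ := ∑' i, d (k + i)

variable {d : ℕ → ℝ} {K : ℕ} {c : ℝ}

lemma HH_succ (d : ℕ → ℝ) {j m : ℕ} (h : j ≤ m) : HH d j (m + 1) = HH d j m + d m :=
  Finset.sum_Ico_succ_top h _

lemma HarmHyp.HH_nonneg (G : HarmHyp q p1 p2 d K c) {j : ℕ} (hj : K ≤ j) (m : ℕ) :
    0 ≤ HH d j m :=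
  Finset.sum_nonneg fun l hl => (G.dpos l (hj.trans (Finset.mem_Ico.1 hl).1)).le

lemma HarmHyp.HH_mono (G : HarmHyp q p1 p2 d K c) {j : ℕ} (hj : K ≤ j) {m n : ℕ} (h : m ≤ n) :
    HH d j m ≤ HH d j n := by
  refine Finset.sum_le_sum_of_subset_of_nonneg (Finset.Ico_subset_Ico le_rfl h) ?_
  intro l hl _
  exact (G.dpos l (hj.trans (Finset.mem_Ico.1 hl).1)).le

lemma HarmHyp.HH_pos (G : HarmHyp q p1 p2 d K c) {j : ℕ} (hj : K ≤ j) {m : ℕ} (h : j < m) :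
    0 < HH d j m := by
  refine Finset.sum_pos ?_ ⟨j, by simp [h]⟩
  intro l hl
  exact G.dpos l (hj.trans (Finset.mem_Ico.1 hl).1)

lemma HarmHyp.summable_shift (G : HarmHyp q p1 p2 d K c) (k : ℕ) : Summable fun i => d (k + i) := by
  have := (summable_nat_add_iff k).2 G.dsum
  simpa [add_comm] using this

lemma HarmHyp.TT_succ (G : HarmHyp q p1 p2 d K c) (k : ℕ) : TT d k = d k + TT d (k + 1) := by
  unfold TT
  rw [(G.summable_shift k).tsum_eq_zero_add]
  simp only [add_zero]
  congr 2
  funext i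
  congr 1
  ring

lemma HarmHyp.TT_pos (G : HarmHyp q p1 p2 d K c) {k : ℕ} (hk : K ≤ k) : 0 < TT d k := by
  exact (G.summable_shift k).tsum_pos (fun i => (G.dpos _ (by omega)).le) 0 (G.dpos _ (by omega))

lemma HarmHyp.TT_HH (G : HarmHyp q p1 p2 d K c) {k m : ℕ} (h : k ≤ m) : 
    TT d k = HH d k m + TT d m := by
  induction m, h using Nat.le_induction with
  | base => simp [HH]
  | succ m hm ih => rw [HH_succ d hm, ih, G.TT_succ m]; ring

lemma HarmHyp.TT_anti (G : HarmHyp q p1 p2 d K c) {k m : ℕ} (hk : K ≤ k) (h : k ≤ m) : 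
    TT d m ≤ TT d k := by
  rw [G.TT_HH h]
  linarith [G.HH_nonneg hk m]

lemma HarmHyp.HH_tendsto (G : HarmHyp q p1 p2 d K c) (k : ℕ) :
    Tendsto (fun m => HH d k m) atTop (𝓝 (TT d k)) := by
  have h1 := (G.summable_shift k).hasSum.tendsto_sum_nat
  rw [← tendsto_add_atTop_iff_nat k]
  refine h1.congr fun n => ?_
  rw [HH, Finset.sum_Ico_eq_sum_range]
  simp

/-- harmonicity in `ENNReal` -/
lemma harm_ennreal (H : WalkHyp q p1 p2) (G : HarmHyp q p1 p2 d K c) {i : ℕ} (hi : K < i)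
    {u v w z : ℝ} (hu : 0 ≤ u) (hw : 0 ≤ w) (hz : 0 ≤ z)
    (h1 : v = u + d (i - 1)) (h2 : w = v + d i) (h3 : z = w + d (i + 1)) :
    ENNReal.ofReal (q i) * ENNReal.ofReal u + ENNReal.ofReal (p1 i) * ENNReal.ofReal w
      + ENNReal.ofReal (p2 i) * ENNReal.ofReal z = ENNReal.ofReal v := by
  have hi2 : 2 ≤ i := by have := G.hK; omega
  have a1 := H.hq i hi2
  have a2 := H.hp1 i hi2
  have a3 := H.hp2 i hi2
  rw [← ENNReal.ofReal_mul a1.le, ← ENNReal.ofReal_mul a2, ← ENNReal.ofReal_mul a3.le,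
    ← ENNReal.ofReal_add (by positivity) (by positivity), 
    ← ENNReal.ofReal_add (by positivity) (by positivity)]
  congr 1
  have h := G.harm i hi
  have hs := H.hsum i hi2
  have : q i = 1 - p1 i - p2 i := by linarith
  subst h3 h2
  have hu' : u = v - d (i - 1) := by linarith
  rw [hu', mul_sub, h]
  rw [this]; ring

lemma harm_trunc (H : WalkHyp q p1 p2) (G : HarmHyp q p1 p2 d K c) {j k i : ℕ} (hj : K ≤ j)
    (hi : i ∈ Set.Ioo j k) :
    ∑' l, ENNReal.ofReal (transY q p1 p2 i l) * ENNReal.ofReal (HH d j (min l (k + 1)))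
      = ENNReal.ofReal (HH d j (min i (k + 1))) := by
  obtain ⟨h1, h2⟩ := hi
  have := G.hK
  rw [tsum_trans i (by omega)]
  rw [min_eq_left (show i - 1 ≤ k + 1 by omega), min_eq_left (show i + 1 ≤ k + 1 by omega), 
    min_eq_left (show i + 2 ≤ k + 1 by omega), min_eq_left (show i ≤ k + 1 by omega)]
  refine harm_ennreal H G (by omega) (G.HH_nonneg hj _) (G.HH_nonneg hj _) (G.HH_nonneg hj _) ?_ ?_ ?_
  · have : i = (i - 1) + 1 := by omega
    conv_lhs => rw [this]
    rw [HH_succ d (by omega)]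
  · rw [HH_succ d (by omega)]
  · rw [HH_succ d (by omega)]

lemma exit_up1 (H : WalkHyp q p1 p2) (G : HarmHyp q p1 p2 d K c) {j k : ℕ} (hj : K ≤ j)
    (hk : j + 1 < k) :
    MM (transY q p1 p2) (Set.Ioo j k) (j + 1) k * ENNReal.ofReal (HH d j k) +
    MM (transY q p1 p2) (Set.Ioo j k) (j + 1) (k + 1) * ENNReal.ofReal (HH d j (k + 1)) 
      ≤ ENNReal.ofReal (d j) := by
  classical
  have h := exit_super (p := transY q p1 p2) (S := Set.Ioo j k) (j + 1) 
    (fun i => ENNReal.ofReal (HH d j (min i (k + 1)))) (fun i hi => (harm_trunc H G hj hi).le)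
  have e : HH d j (min (j + 1) (k + 1)) = d j := by
    rw [min_eq_left (by omega), HH_succ d le_rfl]; simp [HH]
  rw [e] at h
  refine le_trans ?_ h
  refine le_trans ?_ (ENNReal.sum_le_tsum {k, k + 1})
  rw [Finset.sum_pair (by omega), if_neg (by simp), if_neg (by simp)]
  simp

lemma exit_low (H : WalkHyp q p1 p2) (G : HarmHyp q p1 p2 d K c) {j k : ℕ} (hj : K ≤ j)
    (hk : j + 1 < k) : ENNReal.ofReal (d j) ≤
    (MM (transY q p1 p2) (Set.Ioo j k) (j + 1) k +
    MM (transY q p1 p2) (Set.Ioo j k) (j + 1) (k + 1)) * ENNReal.ofReal (HH d j (k + 1)) := by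
  classical
  have hS : ∀ i ∈ Set.Ioo j k, i < k := fun i hi => hi.2
  have h := exit_sub H hS hk 
    (fun i => ENNReal.ofReal (HH d j (min i (k + 1)))) (ENNReal.ofReal (HH d j (k + 1))) (by simp)
    (fun i => ENNReal.ofReal_le_ofReal (G.HH_mono hj (min_le_right _ _)))
    (fun i hi => (harm_trunc H G hj hi).ge)
  have e : HH d j (min (j + 1) (k + 1)) = d j := by
    rw [min_eq_left (by omega), HH_succ d le_rfl]; simp [HH]
  rw [e] at h
  refine le_trans h ?_
  rw [tsum_eq_sum (s := {k, k + 1})]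
  · rw [Finset.sum_pair (by omega), if_neg (by simp), if_neg (by simp), add_mul]
    refine add_le_add ?_ ?_
    · exact mul_le_mul' le_rfl (ENNReal.ofReal_le_ofReal (G.HH_mono hj (min_le_right _ _)))
    · exact mul_le_mul' le_rfl (ENNReal.ofReal_le_ofReal (G.HH_mono hj (min_le_right _ _)))
  · intro i hi
    simp only [Finset.mem_insert, Finset.mem_singleton, not_or] at hi
    split_ifs with hiS
    · rfl
    · by_cases h1 : i ≤ j
      · have : HH d j (min i (k + 1)) = 0 := by
          rw [HH, Finset.Ico_eq_empty (by simp [h1])]; simp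
        rw [this]; simp
      · have h2 : k + 1 < i := by
          simp only [Set.mem_Ioo, not_and, not_lt] at hiS
          have := hiS (by omega)
          omega
        have : MM (transY q p1 p2) (Set.Ioo j k) (j + 1) i = 0 := by
          rw [MM, ENNReal.tsum_eq_zero]
          intro n
          exact mm_support hS hk n i h2
        rw [this, zero_mul]

lemma exit_full (H : WalkHyp q p1 p2) {k x : ℕ} (hx : x < k) : 
    1 ≤ MM (transY q p1 p2) (Set.Iio k) x k + MM (transY q p1 p2) (Set.Iio k) x (k + 1) := by
  classical
  have hS : ∀ i ∈ Set.Iio k, i < k := fun i hi => hi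
  have h := exit_sub H hS hx (fun i => 1) 1 (by simp) (by simp) (by simp [H.row])
  refine le_trans h ?_
  rw [tsum_eq_sum (s := {k, k + 1})]
  · rw [Finset.sum_pair (by omega), if_neg (by simp), if_neg (by simp)]
    simp
  · intro i hi
    simp only [Finset.mem_insert, Finset.mem_singleton, not_or] at hi
    split_ifs with hiS
    · rfl
    · have : MM (transY q p1 p2) (Set.Iio k) x i = 0 := by
        rw [MM, ENNReal.tsum_eq_zero]
        intro n
        refine mm_support hS hx n i ?_
        simp at hiS
        omega
      rw [this, zero_mul]

/-- `k` is a cutpoint. -/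
def Cut (k : ℕ) : Set (ℕ → ℕ) := {ω | ∀ n, ω n ≠ k}

lemma measurableSet_Cut (k : ℕ) : MeasurableSet (Cut k) := by
  unfold Cut
  simp only [Set.ofPred_forall]
  exact MeasurableSet.iInter fun n => (measurableSet_eqAt n k).compl

/-- legal steps -/
def Steps (ω : ℕ → ℕ) : Prop := ∀ n, ω n ≤ ω (n + 1) + 1 ∧ ω (n + 1) ≤ ω n + 2

lemma ae_steps {μ : Measure (ℕ → ℕ)} [IsProbabilityMeasure μ] {x : ℕ} 
    (hμ : IsMarkovChain μ (transY q p1 p2) x) : ∀ᵐ ω ∂μ, ω 0 = x ∧ Steps ω := by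
  filter_upwards [ae_legal hμ] with ω h
  refine ⟨h.1, fun n => ?_⟩
  have := transY_legal (h.2 n)
  omega

lemma Steps.shift {ω : ℕ → ℕ} (h : Steps ω) (n : ℕ) : Steps (shiftP n ω) := fun i => h (n + i)

lemma Steps.stay {ω : ℕ → ℕ} (h : Steps ω) {k : ℕ} (h0 : k < ω 0) (hk : ω ∈ Cut k) (n : ℕ) :
    k < ω n := by
  induction n with
  | zero => exact h0
  | succ n ih =>
    have := (h n).1
    have := hk (n + 1)
    omega

/-- exit of `Ioo j k` upwards -/
lemma Steps.exit {ω : ℕ → ℕ} (h : Steps ω) {j k : ℕ} (h0 : ω 0 ∈ Set.Ioo j k) (hj : ω ∈ Cut j)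
    (hs : ¬ ∀ n, ω n ∈ Set.Ioo j k) : 
    ∃ n, ω ∈ EntS (Set.Ioo j k) n k ∨ ω ∈ EntS (Set.Ioo j k) n (k + 1) := by
  classical
  push Not at hs
  have h1 := Nat.find_spec hs
  have h2 : ∀ m < Nat.find hs, ω m ∈ Set.Ioo j k := fun m hm => not_not.1 (Nat.find_min hs hm)
  refine ⟨Nat.find hs, ?_⟩
  set n := Nat.find hs
  have hn : n ≠ 0 := by
    intro h'
    rw [h'] at h1
    exact h1 h0
  have h3 := h2 (n - 1) (by omega)
  have h4 := h (n - 1)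
  rw [show n - 1 + 1 = n by omega] at h4
  have h5 := hj n
  simp only [Set.mem_Ioo] at h1 h3
  have : ω n = k ∨ ω n = k + 1 := by omega
  rcases this with h6 | h6
  · exact Or.inl ⟨h2, h6⟩
  · exact Or.inr ⟨h2, h6⟩

/-- exit of `Iio k` -/
lemma Steps.exit' {ω : ℕ → ℕ} (h : Steps ω) {k : ℕ} (h0 : ω 0 < k)
    (hs : ¬ ∀ n, ω n ∈ Set.Iio k) : 
    ∃ n, ω ∈ EntS (Set.Iio k) n k ∨ ω ∈ EntS (Set.Iio k) n (k + 1) := by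
  classical
  push Not at hs
  have h1 := Nat.find_spec hs
  have h2 : ∀ m < Nat.find hs, ω m ∈ Set.Iio k := fun m hm => not_not.1 (Nat.find_min hs hm)
  refine ⟨Nat.find hs, ?_⟩
  set n := Nat.find hs
  have hn : n ≠ 0 := by
    intro h'
    rw [h'] at h1
    exact h1 h0
  have h3 := h2 (n - 1) (by omega)
  have h4 := h (n - 1)
  rw [show n - 1 + 1 = n by omega] at h4
  simp only [Set.mem_Iio] at h1 h3
  have : ω n = k ∨ ω n = k + 1 := by omega
  rcases this with h6 | h6
  · exact Or.inl ⟨h2, h6⟩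
  · exact Or.inr ⟨h2, h6⟩

lemma stay_null (H : WalkHyp q p1 p2) {μ : Measure (ℕ → ℕ)} [IsProbabilityMeasure μ] {x : ℕ} 
    (hμ : IsMarkovChain μ (transY q p1 p2) x) {S : Set ℕ} {k : ℕ} (hk : ∀ i ∈ S, i < k) 
    (hx : x < k) : ∀ᵐ ω ∂μ, ¬ ∀ n, ω n ∈ S := by
  rw [ae_iff]
  simp only [not_not]
  refine le_antisymm (ge_of_tendsto' (mm_tendsto H hk hx) fun N => ?_) zero_le
  have : {ω : ℕ → ℕ | ∀ n, ω n ∈ S} ⊆ ⋃ i, EntS S N i := by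
    intro ω hω
    simp only [Set.mem_iUnion]
    exact ⟨ω N, fun m _ => hω m, rfl⟩
  refine le_trans (measure_mono this) (le_trans (measure_iUnion_le _) ?_)
  exact ENNReal.tsum_le_tsum fun i => (measure_EntS hμ S N i).le

lemma restart_upper {μ : Measure (ℕ → ℕ)} [IsProbabilityMeasure μ] {p : ℕ → ℕ → ℝ} {x : ℕ}
    (hμ : IsMarkovChain μ p x) {A : ℕ → Set (ℕ → ℕ)} (hA : ∀ n, MeasurableSet (A n))
    (hd : ∀ n, DetBy n (A n)) (i : ℕ) (hi : ∀ n, ∀ ω ∈ A n, ω n = i) 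
    {B : Set (ℕ → ℕ)} (hB : MeasurableSet B) (α : ℝ≥0∞)
    (h : ∀ ν : Measure (ℕ → ℕ), IsProbabilityMeasure ν → IsMarkovChain ν p i → ν B ≤ α) :
    μ (⋃ n, A n ∩ shiftP n ⁻¹' B) ≤ α * ∑' n, μ (A n) := by
  refine le_trans (measure_iUnion_le _) ?_
  rw [← ENNReal.tsum_mul_left]
  exact ENNReal.tsum_le_tsum fun n => markov_restart_le hμ (hA n) (hd n) i (hi n) hB α h

lemma restart_lower {μ : Measure (ℕ → ℕ)} [IsProbabilityMeasure μ] {p : ℕ → ℕ → ℝ} {x : ℕ}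
    (hμ : IsMarkovChain μ p x) {A : ℕ → Set (ℕ → ℕ)} (hA : ∀ n, MeasurableSet (A n))
    (hd : ∀ n, DetBy n (A n)) (i : ℕ) (S : Set ℕ) (hiS : i ∉ S) (hi : ∀ n, A n ⊆ EntS S n i) 
    {B : Set (ℕ → ℕ)} (hB : MeasurableSet B) (α : ℝ≥0∞)
    (h : ∀ ν : Measure (ℕ → ℕ), IsProbabilityMeasure ν → IsMarkovChain ν p i → α ≤ ν B) :
    α * ∑' n, μ (A n) ≤ μ (⋃ n, A n ∩ shiftP n ⁻¹' B) := by
  rw [measure_iUnion]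
  · rw [← ENNReal.tsum_mul_left]
    exact ENNReal.tsum_le_tsum fun n => 
      markov_restart_ge hμ (hA n) (hd n) i (fun ω hω => (hi n hω).2) hB α h
  · have key : ∀ n m, n < m → ∀ ω, ω ∈ A n → ω ∈ A m → False := by
      intro n m hnm ω h1 h2
      have h3 := (hi m h2).1 n hnm
      rw [(hi n h1).2] at h3
      exact hiS h3
    intro n m hnm
    refine Set.disjoint_left.2 ?_
    rintro ω ⟨h1, _⟩ ⟨h2, _⟩
    rcases lt_or_gt_of_ne hnm with h' | h'
    · exact key n m h' ω h1 h2
    · exact key m n h' ω h2 h1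
  · intro n
    exact (hA n).inter (measurable_shiftP n hB)


end

section

variable {q p1 p2 : ℕ → ℝ} {d : ℕ → ℝ} {K : ℕ} {c : ℝ}

lemma le_ofReal_div {a : ℝ≥0∞} {u v : ℝ} (hv : 0 < v) (h : a * ENNReal.ofReal v ≤ ENNReal.ofReal u) :
    a ≤ ENNReal.ofReal (u / v) := by
  rw [ENNReal.ofReal_div_of_pos hv]
  rwa [ENNReal.le_div_iff_mul_le (Or.inl (by simpa using hv)) (Or.inl (by simp))]

lemma ofReal_div_le {a : ℝ≥0∞} {u v : ℝ} (hv : 0 < v) (h : ENNReal.ofReal u ≤ a * ENNReal.ofReal v) :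
    ENNReal.ofReal (u / v) ≤ a := by
  rw [ENNReal.ofReal_div_of_pos hv]
  exact ENNReal.div_le_of_le_mul h

lemma escape_lower (H : WalkHyp q p1 p2) (G : HarmHyp q p1 p2 d K c) {k : ℕ} (hk : K ≤ k)
    {ν : Measure (ℕ → ℕ)} [IsProbabilityMeasure ν]
    (hν : IsMarkovChain ν (transY q p1 p2) (k + 1)) :
    ENNReal.ofReal (d k / TT d k) ≤ ν (Cut k) := by
  classical
  obtain ⟨S, hS⟩ : ∃ S : Set ℕ, S = Set.Ioi k := ⟨_, rfl⟩
  have h1 : ∀ N, ENNReal.ofReal (d k / TT d k) ≤ ν {ω | ∀ n < N, ω n ∈ S} := by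
    intro N
    refine ofReal_div_le (G.TT_pos hk) ?_
    have a1 := mm_sub (p := transY q p1 p2) (S := S) (k + 1) 
      (fun i => ENNReal.ofReal (HH d k i)) (by
        intro i hi
        have hi' : k < i := by rw [hS] at hi; exact hi
        have := G.hK
        rw [tsum_trans i (by omega)]
        refine (harm_ennreal H G (by omega) (G.HH_nonneg hk _) (G.HH_nonneg hk _) 
          (G.HH_nonneg hk _) ?_ ?_ ?_).ge
        · have : i = (i - 1) + 1 := by omega
          conv_lhs => rw [this]
          rw [HH_succ d (by omega)]
        · rw [HH_succ d (by omega)]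
        · rw [HH_succ d (by omega)]) N
    have e : HH d k (k + 1) = d k := by
      rw [HH_succ d le_rfl]; simp [HH]
    have z : ∑ n ∈ Finset.range N, ∑' i, (if i ∈ S then 0 else 
        mm (transY q p1 p2) S (k + 1) n i * ENNReal.ofReal (HH d k i)) = 0 := by
      refine Finset.sum_eq_zero fun n _ => ?_
      rw [ENNReal.tsum_eq_zero]
      intro i
      split_ifs with hi
      · rfl
      · have : i ≤ k := by rw [hS] at hi; exact not_lt.1 hi
        have : HH d k i = 0 := by
          rw [HH, Finset.Ico_eq_empty (by simp [this])]; simp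
        simp [this]
    rw [e, z, zero_add] at a1
    refine le_trans a1 ?_
    have u : {ω : ℕ → ℕ | ∀ n < N, ω n ∈ S} = ⋃ i, EntS S N i := by
      ext ω
      simp [EntS]
    rw [u, measure_iUnion]
    · rw [← ENNReal.tsum_mul_right]
      refine ENNReal.tsum_le_tsum fun i => ?_
      rw [measure_EntS hν]
      refine mul_le_mul' le_rfl (ENNReal.ofReal_le_ofReal ?_)
      by_cases hi : k ≤ i
      · rw [G.TT_HH hi]
        linarith [G.TT_pos (hk.trans hi)]
      · have : HH d k i = 0 := by
          rw [HH, Finset.Ico_eq_empty (by simp; omega)]; simp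
        rw [this]; exact (G.TT_pos hk).le
    · intro i i' hi
      refine Set.disjoint_left.2 ?_
      rintro ω ⟨_, a⟩ ⟨_, b⟩
      exact hi (a.symm.trans b)
    · exact fun i => measurableSet_EntS S N i
  have h2 : (⋂ N, {ω : ℕ → ℕ | ∀ n < N, ω n ∈ S}) ⊆ Cut k := by
    intro ω hω n hn
    simp only [Set.mem_iInter] at hω
    have := hω (n + 1) n (by omega)
    rw [hn, hS] at this
    exact lt_irrefl k this
  refine le_trans ?_ (measure_mono h2)
  rw [Antitone.measure_iInter]
  · exact le_iInf h1
  · intro a b hab ω hω n hn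
    exact hω n (by omega)
  · intro N
    have : MeasurableSet {ω : ℕ → ℕ | ∀ m < N, ω m ∈ S} := by
      simp only [Set.ofPred_forall]
      exact MeasurableSet.iInter fun i => MeasurableSet.iInter fun _ => measurableSet_memAt _ _
    exact this.nullMeasurableSet
  · exact ⟨0, measure_ne_top _ _⟩

lemma escape_upper (H : WalkHyp q p1 p2) (G : HarmHyp q p1 p2 d K c) {k : ℕ} (hk : K ≤ k)
    {ν : Measure (ℕ → ℕ)} [IsProbabilityMeasure ν]
    (hν : IsMarkovChain ν (transY q p1 p2) (k + 1)) :
    ν (Cut k) ≤ ENNReal.ofReal (d k / TT d k) := by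
  refine le_ofReal_div (G.TT_pos hk) ?_
  have h1 : ∀ m, k + 1 < m → ν (Cut k) * ENNReal.ofReal (HH d k m) ≤ ENNReal.ofReal (d k) := by
    intro m hm
    have a1 := exit_up1 H G hk hm
    have a2 : ν (Cut k) ≤ MM (transY q p1 p2) (Set.Ioo k m) (k + 1) m + 
      MM (transY q p1 p2) (Set.Ioo k m) (k + 1) (m + 1) := by
      have b : ν (Cut k) ≤ ν ((⋃ n, EntS (Set.Ioo k m) n m) ∪ ⋃ n, EntS (Set.Ioo k m) n (m + 1)) := by
        refine measure_mono_ae ?_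
        filter_upwards [ae_steps hν, stay_null H hν (S := Set.Ioo k m) (k := m) (fun i hi => hi.2) 
          (by omega)] with ω ⟨h0, hst⟩ hns hcut
        obtain ⟨n, hn⟩ := hst.exit (j := k) (k := m) (by rw [h0]; exact ⟨by omega, hm⟩) hcut hns
        rcases hn with hn | hn
        · exact Or.inl (Set.mem_iUnion.2 ⟨n, hn⟩)
        · exact Or.inr (Set.mem_iUnion.2 ⟨n, hn⟩)
      refine le_trans b (le_trans (measure_union_le _ _) ?_)
      refine add_le_add ?_ ?_
      · refine le_trans (measure_iUnion_le _) (ENNReal.tsum_le_tsum fun n => (measure_EntS hν _ n _).le)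
      · refine le_trans (measure_iUnion_le _) (ENNReal.tsum_le_tsum fun n => (measure_EntS hν _ n _).le)
    refine le_trans (mul_le_mul' a2 le_rfl) (le_trans ?_ a1)
    rw [add_mul]
    exact add_le_add le_rfl (mul_le_mul' le_rfl (ENNReal.ofReal_le_ofReal (G.HH_mono hk (by omega))))
  have h2 : Tendsto (fun m => ν (Cut k) * ENNReal.ofReal (HH d k m)) atTop 
      (𝓝 (ν (Cut k) * ENNReal.ofReal (TT d k))) :=
    ENNReal.Tendsto.const_mul (ENNReal.tendsto_ofReal (G.HH_tendsto k)) (Or.inr (measure_ne_top _ _))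
  refine le_of_tendsto h2 ?_
  filter_upwards [eventually_gt_atTop (k + 1)] with m hm
  exact h1 m hm

lemma cut2_upper (H : WalkHyp q p1 p2) (G : HarmHyp q p1 p2 d K c) {j k : ℕ} (hj : K ≤ j)
    (hjk : j < k) {ν : Measure (ℕ → ℕ)} [IsProbabilityMeasure ν]
    (hν : IsMarkovChain ν (transY q p1 p2) (j + 1)) :
    ν (Cut j ∩ Cut k) ≤ ENNReal.ofReal (d j / HH d j (k + 1) * (d k / TT d k)) := by
  by_cases hk : k = j + 1
  · have : ν (Cut j ∩ Cut k) = 0 := by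
      have : ∀ᵐ ω ∂ν, ω ∉ Cut j ∩ Cut k := by
        filter_upwards [ae_steps hν] with ω ⟨h0, _⟩ h
        exact h.2 0 (by omega)
      exact (measure_eq_zero_iff_ae_notMem).2 this
    rw [this]; exact zero_le
  have hk' : j + 1 < k := by omega
  have a1 : MM (transY q p1 p2) (Set.Ioo j k) (j + 1) (k + 1) ≤ ENNReal.ofReal (d j / HH d j (k + 1)) :=
    le_ofReal_div (G.HH_pos hj (by omega)) (le_trans le_add_self (exit_up1 H G hj hk'))
  have a2 : ν (Cut j ∩ Cut k) ≤ ν (⋃ n, EntS (Set.Ioo j k) n (k + 1) ∩ shiftP n ⁻¹' Cut k) := by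
    refine measure_mono_ae ?_
    filter_upwards [ae_steps hν, stay_null H hν (S := Set.Ioo j k) (k := k) (fun i hi => hi.2) 
      (by omega)] with ω ⟨h0, hst⟩ hns hcut
    obtain ⟨n, hn⟩ := hst.exit (j := j) (k := k) (by rw [h0]; exact ⟨by omega, hk'⟩) hcut.1 hns
    rcases hn with hn | hn
    · exact absurd hn.2 (hcut.2 n)
    · exact Set.mem_iUnion.2 ⟨n, hn, fun i => hcut.2 (n + i)⟩
  have a3 := restart_upper hν (A := fun n => EntS (Set.Ioo j k) n (k + 1)) 
    (fun n => measurableSet_EntS _ _ _) (fun n => detBy_EntS _ _ _) (k + 1) (fun n ω hω => hω.2)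
    (measurableSet_Cut k) (ENNReal.ofReal (d k / TT d k)) 
    (fun ν' h1 h2 => escape_upper H G (by omega) h2)
  refine le_trans a2 (le_trans a3 ?_)
  have dj := G.dpos j hj
  rw [mul_comm, ENNReal.ofReal_mul (div_nonneg dj.le (G.HH_nonneg hj _))]
  refine mul_le_mul' (le_trans ?_ a1) le_rfl
  exact ENNReal.tsum_le_tsum fun n => (measure_EntS hν _ n _).le

lemma cut2_lower (H : WalkHyp q p1 p2) (G : HarmHyp q p1 p2 d K c) {j k : ℕ} (hj : K ≤ j)
    (hjk : j + 4 ≤ k) {ν : Measure (ℕ → ℕ)} [IsProbabilityMeasure ν]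
    (hν : IsMarkovChain ν (transY q p1 p2) (j + 1)) :
    ENNReal.ofReal (c ^ 3 / 3 * (d j / HH d j (k + 1) * (d k / TT d k))) ≤ ν (Cut j ∩ Cut k) := by
  have hk' : j + 1 < k := by omega
  have c0 := G.c0
  have a0 := ofReal_div_le (G.HH_pos hj (by omega)) (exit_low H G hj hk')
  have a1 := MM_exit_compare H G.c0 G.hK G.cq G.cp (S := Set.Ioo j k) (k := k) (fun i hi => hi.2)
    (x := j + 1) hk' (by omega) ⟨by omega, by omega⟩ ⟨by omega, by omega⟩ ⟨by omega, by omega⟩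
  have a2 : ν (⋃ n, EntS (Set.Ioo j k) n (k + 1) ∩ shiftP n ⁻¹' Cut k) ≤ ν (Cut j ∩ Cut k) := by
    refine measure_mono_ae ?_
    filter_upwards [ae_steps hν] with ω ⟨h0, hst⟩ hω
    obtain ⟨n, ⟨h1, h2⟩, h3⟩ := Set.mem_iUnion.1 hω
    have h4 := (hst.shift n).stay (k := k) (by simp [shiftP, h2]) h3
    have h5 : ∀ m, n ≤ m → k < ω m := by
      intro m hm
      have := h4 (m - n)
      simp only [shiftP] at this
      rwa [show n + (m - n) = m by omega] at this
    refine ⟨fun m => ?_, fun m => ?_⟩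
    · by_cases hm : m < n
      · exact (h1 m hm).1.ne'
      · have := h5 m (by omega)
        omega
    · by_cases hm : m < n
      · exact (h1 m hm).2.ne
      · have := h5 m (by omega)
        omega
  have a3 := restart_lower hν (A := fun n => EntS (Set.Ioo j k) n (k + 1)) 
    (fun n => measurableSet_EntS _ _ _) (fun n => detBy_EntS _ _ _) (k + 1) (Set.Ioo j k) 
    (by simp) (fun n => subset_rfl)
    (measurableSet_Cut k) (ENNReal.ofReal (d k / TT d k)) 
    (fun ν' h1 h2 => escape_lower H G (by omega) h2)
  refine le_trans (le_trans ?_ a3) a2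
  have dj := G.dpos j hj
  have hh := div_nonneg dj.le (G.HH_nonneg hj (k + 1))
  rw [mul_comm (ENNReal.ofReal (d k / TT d k)), ← mul_assoc, ENNReal.ofReal_mul (by positivity),
    ENNReal.ofReal_mul (by positivity)]
  refine mul_le_mul' ?_ le_rfl
  have : ∑' n, ν (EntS (Set.Ioo j k) n (k + 1)) = MM (transY q p1 p2) (Set.Ioo j k) (j + 1) (k + 1) :=
    tsum_congr fun n => measure_EntS hν _ n _
  rw [this]
  exact le_trans (mul_le_mul' le_rfl a0) a1

/-- `j` is the first cutpoint in `[M, ∞)`. -/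
def Fst (M j : ℕ) : Set (ℕ → ℕ) := Cut j ∩ {ω | ∀ l, M ≤ l → l < j → ∃ n, ω n = l}

lemma measurableSet_Fst (M j : ℕ) : MeasurableSet (Fst M j) := by
  refine (measurableSet_Cut j).inter ?_
  simp only [Set.ofPred_forall, Set.ofPred_exists]
  exact MeasurableSet.iInter fun _ => MeasurableSet.iInter fun _ => MeasurableSet.iInter fun _ =>
    MeasurableSet.iUnion fun _ => measurableSet_eqAt _ _

/-- initial part of `Fst` -/
def AA (M j n : ℕ) : Set (ℕ → ℕ) := 
  EntS (Set.Iio j) n (j + 1) ∩ {ω | ∀ l, M ≤ l → l < j → ∃ m, m ≤ n ∧ ω m = l}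

lemma measurableSet_AA (M j n : ℕ) : MeasurableSet (AA M j n) := by
  refine (measurableSet_EntS _ _ _).inter ?_
  simp only [Set.ofPred_forall, Set.ofPred_exists, Set.ofPred_and]
  exact MeasurableSet.iInter fun _ => MeasurableSet.iInter fun _ => MeasurableSet.iInter fun _ =>
    MeasurableSet.iUnion fun _ => (MeasurableSet.const _).inter (measurableSet_eqAt _ _)

lemma detBy_AA (M j n : ℕ) : DetBy n (AA M j n) := by
  rintro ω ω' h ⟨h1, h2⟩
  refine ⟨detBy_EntS _ _ _ ω ω' h h1, fun l hl hlj => ?_⟩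
  obtain ⟨m, hm, hml⟩ := h2 l hl hlj
  exact ⟨m, hm, by rw [← h m hm, hml]⟩

lemma renew_ae (H : WalkHyp q p1 p2) {μ : Measure (ℕ → ℕ)} [IsProbabilityMeasure μ] {x : ℕ} 
    (hμ : IsMarkovChain μ (transY q p1 p2) x) {M j k : ℕ} (hx : x < j) (hk : j ≤ k) :
    μ (Fst M j ∩ Cut k) = μ (⋃ n, AA M j n ∩ shiftP n ⁻¹' (Cut j ∩ Cut k)) := by
  refine measure_congr ?_
  filter_upwards [ae_steps hμ, stay_null H hμ (S := Set.Iio j) (k := j) (fun i hi => hi) hx] with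
    ω ⟨h0, hst⟩ hns
  refine propext ⟨?_, ?_⟩
  · rintro ⟨⟨h1, h2⟩, h3⟩
    obtain ⟨n, hn⟩ := hst.exit' (k := j) (by omega) hns
    rcases hn with hn | hn
    · exact absurd hn.2 (h1 n)
    · have hc : shiftP n ω ∈ Cut j := fun i => h1 (n + i)
      refine Set.mem_iUnion.2 ⟨n, ⟨hn, fun l hl hlj => ?_⟩, hc, fun i => h3 (n + i)⟩
      obtain ⟨m, hm⟩ := h2 l hl hlj
      refine ⟨m, ?_, hm⟩
      by_contra hcon
      have h4 := (hst.shift n).stay (k := j) (by simp [shiftP, hn.2]) hc (m - n)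
      simp only [shiftP] at h4
      rw [show n + (m - n) = m by omega] at h4
      omega
  · intro hω
    obtain ⟨n, ⟨h1, h2⟩, h3, h4⟩ := Set.mem_iUnion.1 hω
    have key : ∀ l, j ≤ l → shiftP n ω ∈ Cut l → ω ∈ Cut l := by
      intro l hl hc m hm
      by_cases hmn : m < n
      · have : ω m < j := h1.1 m hmn
        omega
      · apply hc (m - n)
        simp only [shiftP]
        rw [show n + (m - n) = m by omega]
        exact hm
    refine ⟨⟨key j le_rfl h3, fun l hl hlj => ?_⟩, key k hk h4⟩
    obtain ⟨m, _, hm⟩ := h2 l hl hlj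
    exact ⟨m, hm⟩

/-- renewal weight -/
def QQ (μ : Measure (ℕ → ℕ)) (M j : ℕ) : ℝ≥0∞ := ∑' n, μ (AA M j n)

lemma renew_le (H : WalkHyp q p1 p2) {μ : Measure (ℕ → ℕ)} [IsProbabilityMeasure μ] {x : ℕ} 
    (hμ : IsMarkovChain μ (transY q p1 p2) x) {M j k : ℕ} (hx : x < j) (hk : j ≤ k) (α : ℝ≥0∞)
    (h : ∀ ν : Measure (ℕ → ℕ), IsProbabilityMeasure ν → 
      IsMarkovChain ν (transY q p1 p2) (j + 1) → ν (Cut j ∩ Cut k) ≤ α) : 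
    μ (Fst M j ∩ Cut k) ≤ α * QQ μ M j := by
  rw [renew_ae H hμ hx hk]
  exact restart_upper hμ (measurableSet_AA M j) (detBy_AA M j) (j + 1) (fun n ω hω => hω.1.2)
    ((measurableSet_Cut j).inter (measurableSet_Cut k)) α h

lemma renew_ge (H : WalkHyp q p1 p2) {μ : Measure (ℕ → ℕ)} [IsProbabilityMeasure μ] {x : ℕ} 
    (hμ : IsMarkovChain μ (transY q p1 p2) x) {M j k : ℕ} (hx : x < j) (hk : j ≤ k) (α : ℝ≥0∞)
    (h : ∀ ν : Measure (ℕ → ℕ), IsProbabilityMeasure ν → 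
      IsMarkovChain ν (transY q p1 p2) (j + 1) → α ≤ ν (Cut j ∩ Cut k)) : 
    α * QQ μ M j ≤ μ (Fst M j ∩ Cut k) := by
  rw [renew_ae H hμ hx hk]
  exact restart_lower hμ (measurableSet_AA M j) (detBy_AA M j) (j + 1) (Set.Iio j) (by simp) 
    (fun n ω hω => hω.1) ((measurableSet_Cut j).inter (measurableSet_Cut k)) α h

lemma Fst_inter_self (M j : ℕ) : Fst M j ∩ Cut j = Fst M j := by
  unfold Fst
  rw [Set.inter_right_comm, Set.inter_self]

lemma Fst_self (j : ℕ) : Fst j j = Cut j := by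
  unfold Fst
  refine Set.inter_eq_left.2 fun ω _ l h1 h2 => ?_
  omega

lemma measure_Fst (H : WalkHyp q p1 p2) (G : HarmHyp q p1 p2 d K c) 
    {μ : Measure (ℕ → ℕ)} [IsProbabilityMeasure μ] {x : ℕ} 
    (hμ : IsMarkovChain μ (transY q p1 p2) x) {M j : ℕ} (hx : x < j) (hj : K ≤ j) :
    μ (Fst M j) = ENNReal.ofReal (d j / TT d j) * QQ μ M j := by
  refine le_antisymm ?_ ?_
  · have := renew_le H hμ (M := M) hx le_rfl (ENNReal.ofReal (d j / TT d j)) (by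
      intro ν h1 h2
      rw [Set.inter_self]
      exact escape_upper H G hj h2)
    rwa [Fst_inter_self] at this
  · have := renew_ge H hμ (M := M) hx le_rfl (ENNReal.ofReal (d j / TT d j)) (by
      intro ν h1 h2
      rw [Set.inter_self]
      exact escape_lower H G hj h2)
    rwa [Fst_inter_self] at this

/-- conditional probability of `k` being a cutpoint given that `j` is one, up to constants -/
def rr (d : ℕ → ℝ) (j k : ℕ) : ℝ := TT d j / HH d j (k + 1) * (d k / TT d k)

lemma Fst_Cut_upper (H : WalkHyp q p1 p2) (G : HarmHyp q p1 p2 d K c) 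
    {μ : Measure (ℕ → ℕ)} [IsProbabilityMeasure μ] {x : ℕ} 
    (hμ : IsMarkovChain μ (transY q p1 p2) x) {M j k : ℕ} (hx : x < j) (hj : K ≤ j) (hjk : j < k) :
    μ (Fst M j ∩ Cut k) ≤ ENNReal.ofReal (rr d j k) * μ (Fst M j) := by
  have h := renew_le H hμ (M := M) hx hjk.le (ENNReal.ofReal (d j / HH d j (k + 1) * (d k / TT d k)))
    (fun ν h1 h2 => cut2_upper H G hj hjk h2)
  refine le_trans h ?_
  have t := G.TT_pos hj
  have t' := G.TT_pos (show K ≤ k by omega)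
  have d' := G.dpos k (by omega)
  have hh := G.HH_pos hj (show j < k + 1 by omega)
  rw [measure_Fst H G hμ hx hj, ← mul_assoc, ← ENNReal.ofReal_mul (by unfold rr; positivity)]
  refine mul_le_mul' (ENNReal.ofReal_le_ofReal (le_of_eq ?_)) le_rfl
  unfold rr
  field_simp

lemma Fst_Cut_lower (H : WalkHyp q p1 p2) (G : HarmHyp q p1 p2 d K c) 
    {μ : Measure (ℕ → ℕ)} [IsProbabilityMeasure μ] {x : ℕ} 
    (hμ : IsMarkovChain μ (transY q p1 p2) x) {M j k : ℕ} (hx : x < j) (hj : K ≤ j) 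
    (hjk : j + 4 ≤ k) :
    ENNReal.ofReal (c ^ 3 / 3 * rr d j k) * μ (Fst M j) ≤ μ (Fst M j ∩ Cut k) := by
  have h := renew_ge H hμ (M := M) hx (show j ≤ k by omega) _
    (fun ν h1 h2 => cut2_lower H G hj hjk h2)
  refine le_trans ?_ h
  have t := G.TT_pos hj
  have t' := G.TT_pos (show K ≤ k by omega)
  have d' := G.dpos k (by omega)
  have c0 := G.c0
  have hh := G.HH_pos hj (show j < k + 1 by omega)
  rw [measure_Fst H G hμ hx hj, ← mul_assoc, ← ENNReal.ofReal_mul (by unfold rr; positivity)]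
  refine mul_le_mul' (ENNReal.ofReal_le_ofReal (le_of_eq ?_)) le_rfl
  unfold rr
  field_simp

lemma AA_self (j n : ℕ) : AA j j n = EntS (Set.Iio j) n (j + 1) := by
  unfold AA
  refine Set.inter_eq_left.2 fun ω _ l h1 h2 => ?_
  omega

lemma QQ_self {μ : Measure (ℕ → ℕ)} [IsProbabilityMeasure μ] {x : ℕ} 
    (hμ : IsMarkovChain μ (transY q p1 p2) x) (j : ℕ) : 
    QQ μ j j = MM (transY q p1 p2) (Set.Iio j) x (j + 1) := by
  unfold QQ MM
  refine tsum_congr fun n => ?_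
  rw [AA_self, measure_EntS hμ]

lemma Cut_upper (H : WalkHyp q p1 p2) (G : HarmHyp q p1 p2 d K c) 
    {μ : Measure (ℕ → ℕ)} [IsProbabilityMeasure μ] {x : ℕ} 
    (hμ : IsMarkovChain μ (transY q p1 p2) x) {k : ℕ} (hx : x < k) (hk : K ≤ k) :
    μ (Cut k) ≤ ENNReal.ofReal (d k / TT d k) := by
  rw [← Fst_self, measure_Fst H G hμ hx hk, QQ_self hμ]
  refine mul_le_of_le_one_right' ?_
  exact MM_le_one H _ _ _ (by simp)

lemma Cut_lower (H : WalkHyp q p1 p2) (G : HarmHyp q p1 p2 d K c) 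
    {μ : Measure (ℕ → ℕ)} [IsProbabilityMeasure μ] {x : ℕ} 
    (hμ : IsMarkovChain μ (transY q p1 p2) x) {k : ℕ} (hx : x < k) (hk : K + 3 ≤ k) :
    ENNReal.ofReal (c ^ 3 / 3) * ENNReal.ofReal (d k / TT d k) ≤ μ (Cut k) := by
  rw [← Fst_self, measure_Fst H G hμ hx (by omega), QQ_self hμ, mul_comm]
  refine mul_le_mul' le_rfl ?_
  have a1 := MM_exit_compare H G.c0 G.hK G.cq G.cp (S := Set.Iio k) (k := k) (fun i hi => hi)
    (x := x) hx hk (by simp; omega) (by simp; omega) (by simp; omega)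
  have a2 := exit_full H hx
  refine le_trans ?_ a1
  calc ENNReal.ofReal (c ^ 3 / 3) = ENNReal.ofReal (c ^ 3 / 3) * 1 := by simp
    _ ≤ _ := mul_le_mul' le_rfl a2


end

section

variable {q p1 p2 d L : ℕ → ℝ} {K : ℕ} {c : ℝ}

/-- Growth hypotheses for the increments `d`. -/
structure LH (L d : ℕ → ℝ) (K : ℕ) : Prop where
  hK : 16 ≤ K
  L1 : ∀ n, K ≤ n → 1 ≤ L n
  Lm : ∀ n, K ≤ n → L n ≤ L (n + 1)
  Ll : ∀ n, K ≤ n → L n ≤ Real.log n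
  dpos : ∀ n, K ≤ n → 0 < d n
  dm : ∀ n, K ≤ n → d (n + 1) ≤ d n
  du : ∀ n, K ≤ n → d n ≤ (1 + 3 / ((n : ℝ) + 1)) * d (n + 1)
  ph1 : ∀ n, K ≤ n → d (n + 1) / 2 ≤ n * L n * d n - (n + 1) * L (n + 1) * d (n + 1)
  ph2 : ∀ n, K ≤ n → n * L n * d n - (n + 1) * L (n + 1) * d (n + 1) ≤ 2 * d (n + 1)

lemma log_sub_le {x y : ℝ} (hx : 0 < x) (hy : 0 < y) : Real.log y - Real.log x ≤ (y - x) / x := by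
  rw [← Real.log_div hy.ne' hx.ne']
  have := Real.log_le_sub_one_of_pos (div_pos hy hx)
  rw [sub_div, div_self hx.ne']
  exact this

/-- `log log` telescoping -/
lemma loglog_step {n : ℕ} (hn : 3 ≤ n) :
    Real.log (Real.log ((n + 1 : ℕ) : ℝ)) - Real.log (Real.log n) ≤ 1 / (n * Real.log n) := by
  have h3 : (3 : ℝ) ≤ n := by exact_mod_cast hn
  have l1 : 0 < Real.log n := Real.log_pos (by linarith)
  have l2 : 0 < Real.log ((n + 1 : ℕ) : ℝ) := Real.log_pos (by push_cast; linarith)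
  refine (log_sub_le l1 l2).trans ?_
  have := log_sub_le (x := n) (y := ((n + 1 : ℕ) : ℝ)) (by linarith) (by push_cast; linarith)
  rw [← div_div]
  refine div_le_div_of_nonneg_right (this.trans ?_) l1.le
  push_cast
  simp

lemma loglog_tele {m n : ℕ} (hm : 3 ≤ m) (h : m ≤ n) :
    Real.log (Real.log n) - Real.log (Real.log m) ≤ ∑ i ∈ Finset.Ico m n, 1 / (i * Real.log i) := by
  induction n, h using Nat.le_induction with
  | base => simp
  | succ n hn ih =>
    rw [Finset.sum_Ico_succ_top hn]
    have := loglog_step (n := n) (by omega)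
    linarith

lemma tendsto_loglog : Tendsto (fun n : ℕ => Real.log (Real.log n)) atTop atTop :=
  Real.tendsto_log_atTop.comp (Real.tendsto_log_atTop.comp tendsto_natCast_atTop_atTop)

lemma LH.W_pos (B : LH L d K) {n : ℕ} (hn : K ≤ n) : 0 < n * L n := by
  have h1 := B.L1 n hn
  have h2 := B.hK
  have : (0 : ℝ) < n := by exact_mod_cast (by omega : 0 < n)
  positivity

lemma LH.phi_nonneg (B : LH L d K) {n : ℕ} (hn : K ≤ n) : 0 ≤ n * L n * d n :=
  mul_nonneg (B.W_pos hn).le (B.dpos n hn).le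

lemma LH.Lmono (B : LH L d K) {j k : ℕ} (hj : K ≤ j) (h : j ≤ k) : L j ≤ L k := by
  induction k, h using Nat.le_induction with
  | base => exact le_rfl
  | succ n hn ih => exact ih.trans (B.Lm n (by omega))

lemma LH.danti (B : LH L d K) {j k : ℕ} (hj : K ≤ j) (h : j ≤ k) : d k ≤ d j := by
  induction k, h using Nat.le_induction with
  | base => exact le_rfl
  | succ n hn ih => exact (B.dm n (by omega)).trans ih

lemma LH.dcube (B : LH L d K) {j k : ℕ} (hj : K ≤ j) (h : j ≤ k) :
    (j : ℝ) ^ 3 * d j ≤ (k : ℝ) ^ 3 * d k := by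
  induction k, h using Nat.le_induction with
  | base => exact le_rfl
  | succ n hn ih =>
    refine ih.trans ?_
    have h1 := B.du n (by omega)
    have h2 := B.dpos (n + 1) (by omega)
    calc (n : ℝ) ^ 3 * d n ≤ (n : ℝ) ^ 3 * ((1 + 3 / ((n : ℝ) + 1)) * d (n + 1)) := by gcongr
      _ = ((n : ℝ) ^ 3 * (1 + 3 / ((n : ℝ) + 1))) * d (n + 1) := by ring
      _ ≤ _ := by
        refine mul_le_mul_of_nonneg_right ?_ h2.le
        have hn0 : (0 : ℝ) ≤ n := Nat.cast_nonneg n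
        push_cast
        have : (1 + 3 / ((n : ℝ) + 1)) = (n + 4) / (n + 1) := by field_simp; ring
        rw [this, ← mul_div_assoc, div_le_iff₀ (by positivity)]
        nlinarith [pow_nonneg hn0 2, pow_nonneg hn0 3]

lemma LH.d8 (B : LH L d K) {j k : ℕ} (hj : K ≤ j) (h : j ≤ k) (h2 : k ≤ 2 * j) : d j / 8 ≤ d k := by
  have h1 := B.dcube hj h
  have hk := B.dpos k (by omega)
  have := B.hK
  have j0 : (0 : ℝ) < j := by exact_mod_cast (by omega : 0 < j)
  have h2' : (k : ℝ) ≤ 2 * j := by exact_mod_cast h2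
  have h3 : (k : ℝ) ^ 3 * d k ≤ (2 * j) ^ 3 * d k := by gcongr
  have h4 : (j : ℝ) ^ 3 * d j ≤ (j : ℝ) ^ 3 * (8 * d k) := by linarith
  have := le_of_mul_le_mul_left h4 (by positivity)
  linarith

lemma LH.summable (B : LH L d K) : Summable d := by
  rw [← summable_nat_add_iff (K + 1)]
  refine summable_of_sum_range_le (c := 2 * (K * L K * d K)) 
    (fun n => (B.dpos _ (by omega)).le) fun n => ?_
  have : ∑ i ∈ Finset.range n, d (i + (K + 1)) ≤ 
      2 * (K * L K * d K - ((K + n : ℕ) : ℝ) * L (K + n) * d (K + n)) := by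
    induction n with
    | zero => simp
    | succ n ih =>
      rw [Finset.sum_range_succ]
      have := B.ph1 (K + n) (by omega)
      have e : n + (K + 1) = K + n + 1 := by ring
      rw [e, show K + (n + 1) = K + n + 1 by ring]
      push_cast at *
      linarith
  have h2 := B.phi_nonneg (n := K + n) (by omega)
  linarith

lemma LH.phi_small (B : LH L d K) {ε : ℝ} (hε : 0 < ε) (n : ℕ) (hn : K ≤ n) :
    ∃ m, n ≤ m ∧ m * L m * d m < ε := by
  by_contra! hc
  have hs := B.summable
  have hK := B.hK
  have hb : ∀ m, n ≤ m → ε * (1 / (m * Real.log m)) ≤ d m := by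
    intro m hm
    have h1 := hc m hm
    have h2 := B.Ll m (by omega)
    have h3 := B.L1 m (by omega)
    have h4 := B.dpos m (by omega)
    have m0 : (0 : ℝ) < m := by exact_mod_cast (by omega : 0 < m)
    have : (0 : ℝ) < m * Real.log m := mul_pos m0 (by linarith)
    rw [mul_one_div, div_le_iff₀ this]
    refine h1.trans ?_
    rw [mul_comm (d m)]
    gcongr
  have hT : ∀ m, n ≤ m → ε * (Real.log (Real.log m) - Real.log (Real.log n)) ≤ ∑' i, d (i + n) := by
    intro m hm
    calc _ ≤ ε * ∑ i ∈ Finset.Ico n m, 1 / (i * Real.log i) := by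
          have := loglog_tele (by omega) hm
          gcongr
      _ = ∑ i ∈ Finset.Ico n m, ε * (1 / (i * Real.log i)) := by rw [Finset.mul_sum]
      _ ≤ ∑ i ∈ Finset.Ico n m, d i := 
          Finset.sum_le_sum fun i hi => hb i (Finset.mem_Ico.1 hi).1
      _ = ∑ i ∈ Finset.range (m - n), d (i + n) := by
          rw [Finset.sum_Ico_eq_sum_range]
          exact Finset.sum_congr rfl fun i _ => by rw [add_comm]
      _ ≤ _ := ((summable_nat_add_iff n).2 hs).sum_le_tsum _ 
          (fun i _ => (B.dpos _ (by omega)).le)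
  have ht := tendsto_loglog.eventually_gt_atTop
    ((∑' i, d (i + n)) / ε + Real.log (Real.log n))
  obtain ⟨m, h1, h2⟩ := (ht.and (eventually_ge_atTop n)).exists
  have := hT m h2
  rw [← lt_sub_iff_add_lt, div_lt_iff₀ hε] at h1
  linarith

lemma phi_tele (B : LH L d K) {n m : ℕ} (hn : K ≤ n) (h : n ≤ m) :
    HH d (n + 1) (m + 1) / 2 ≤ n * L n * d n - m * L m * d m ∧
    n * L n * d n - m * L m * d m ≤ 2 * HH d (n + 1) (m + 1) := by
  induction m, h using Nat.le_induction with
  | base => simp [HH]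
  | succ m hm ih =>
    rw [HH_succ d (by omega)]
    have h1 := B.ph1 m (by omega)
    have h2 := B.ph2 m (by omega)
    push_cast
    constructor <;> linarith [ih.1, ih.2]

section

lemma phi_lower (G : HarmHyp q p1 p2 d K c) (B : LH L d K)
    {n : ℕ} (hn : K ≤ n) : TT d (n + 1) / 2 ≤ n * L n * d n := by
  have := (G.HH_tendsto (n + 1)).comp (tendsto_add_atTop_nat 1)
  refine le_of_tendsto (this.div_const 2) ?_
  filter_upwards [eventually_ge_atTop n] with m hm
  have h1 := (phi_tele B hn hm).1
  have h2 := B.phi_nonneg (n := m) (by omega)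
  simp only [Function.comp]
  linarith

lemma phi_upper (G : HarmHyp q p1 p2 d K c) (B : LH L d K)
    {n : ℕ} (hn : K ≤ n) : n * L n * d n ≤ 2 * TT d (n + 1) := by
  refine le_of_forall_pos_le_add fun ε hε => ?_
  obtain ⟨m, hm, h⟩ := B.phi_small hε n hn
  have h1 := (phi_tele B hn hm).2
  have h2 := G.TT_HH (d := d) (show n + 1 ≤ m + 1 by omega)
  have h3 := G.TT_pos (show K ≤ m + 1 by omega)
  linarith

lemma TT_le (G : HarmHyp q p1 p2 d K c) (B : LH L d K)
    {n : ℕ} (hn : K ≤ n) : TT d n ≤ 3 * (n * L n) * d n := by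
  have h1 := phi_lower G B hn
  rw [G.TT_succ]
  have h2 := B.dpos n hn
  have h3 := B.L1 n hn
  have h4 := B.hK
  have h5 : (1 : ℝ) ≤ n := by exact_mod_cast (by omega : 1 ≤ n)
  have : 1 * d n ≤ n * L n * d n := by
    refine mul_le_mul_of_nonneg_right ?_ h2.le
    nlinarith
  linarith

lemma le_TT (G : HarmHyp q p1 p2 d K c) (B : LH L d K)
    {n : ℕ} (hn : K ≤ n) : n * L n * d n ≤ 2 * TT d n := by
  have h1 := phi_upper G B hn
  have := G.TT_anti hn (Nat.le_succ n)
  linarith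

lemma n4u (G : HarmHyp q p1 p2 d K c) (B : LH L d K)
    {k : ℕ} (hk : K ≤ k) : d k / TT d k ≤ 2 / (k * L k) := by
  rw [div_le_div_iff₀ (G.TT_pos hk) (B.W_pos hk)]
  have := le_TT G B hk
  linarith

lemma n4l (G : HarmHyp q p1 p2 d K c) (B : LH L d K)
    {k : ℕ} (hk : K ≤ k) : 1 / (3 * (k * L k)) ≤ d k / TT d k := by
  have := B.W_pos hk
  rw [div_le_div_iff₀ (by positivity) (G.TT_pos hk)]
  have := TT_le G B hk
  linarith

lemma HH_ge_mul (G : HarmHyp q p1 p2 d K c) (B : LH L d K)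
    {j m i : ℕ} (hj : K ≤ j) (hm : j ≤ m) (hi : m ≤ i + 1) : 
    ((m : ℝ) - j) * d i ≤ HH d j m := by
  have : ∑ l ∈ Finset.Ico j m, d i ≤ HH d j m := by
    refine Finset.sum_le_sum fun l hl => ?_
    rw [Finset.mem_Ico] at hl
    exact B.danti (by omega) (by omega)
  rw [Finset.sum_const, Nat.card_Ico, nsmul_eq_mul, Nat.cast_sub hm] at this
  exact this

lemma HH_le_mul (G : HarmHyp q p1 p2 d K c) (B : LH L d K)
    {j m : ℕ} (hj : K ≤ j) (hm : j ≤ m) : 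
    HH d j m ≤ ((m : ℝ) - j) * d j := by
  have : HH d j m ≤ ∑ l ∈ Finset.Ico j m, d j := by
    refine Finset.sum_le_sum fun l hl => ?_
    rw [Finset.mem_Ico] at hl
    exact B.danti (by omega) (by omega)
  rw [Finset.sum_const, Nat.card_Ico, nsmul_eq_mul, Nat.cast_sub hm] at this
  exact this

lemma n1 (G : HarmHyp q p1 p2 d K c) (B : LH L d K)
    {j k : ℕ} (hj : K ≤ j) (h : j < k) : rr d j k ≤ 48 / ((k : ℝ) - j) := by
  have hK := B.hK
  have j0 : (0 : ℝ) < j := by exact_mod_cast (by omega : 0 < j)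
  have jk : (j : ℝ) < k := by exact_mod_cast h
  have k0 : (0 : ℝ) < k := j0.trans jk
  have hp := G.HH_pos hj (show j < k + 1 by omega)
  have dj := B.dpos j hj
  have Wk := B.W_pos (show K ≤ k by omega)
  have key : rr d j k ≤ 6 * (j / k) * (d j / HH d j (k + 1)) := by
    calc rr d j k ≤ (3 * (j * L j) * d j) / HH d j (k + 1) * (2 / (k * L k)) := by
          refine mul_le_mul ?_ (n4u G B (by omega)) ?_ ?_
          · exact div_le_div_of_nonneg_right (TT_le G B hj) hp.le
          · exact div_nonneg (B.dpos k (by omega)).le (G.TT_pos (by omega)).le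
          · have := B.W_pos hj
            positivity
      _ = 6 * (j / k) * (L j / L k) * (d j / HH d j (k + 1)) := by
          have : L k ≠ 0 := by have := B.L1 k (by omega); positivity
          field_simp
          ring
      _ ≤ 6 * (j / k) * 1 * (d j / HH d j (k + 1)) := by
          have : L j / L k ≤ 1 := by
            have h1 := B.L1 k (by omega)
            rw [div_le_one (by linarith)]
            exact B.Lmono hj h.le
          gcongr
      _ = _ := by ring
  refine key.trans ?_
  have hkj : (0 : ℝ) < k - j := by linarith
  by_cases h2 : k ≤ 2 * j
  · have a1 := HH_ge_mul G B hj h.le (i := k) (by omega)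
    have a2 := G.HH_mono hj (show k ≤ k + 1 by omega)
    have a3 := B.d8 hj h.le h2
    have a4 : ((k : ℝ) - j) * (d j / 8) ≤ HH d j (k + 1) :=
      (mul_le_mul_of_nonneg_left a3 hkj.le).trans (a1.trans a2)
    have : d j / HH d j (k + 1) ≤ 8 / (k - j) := by
      rw [div_le_div_iff₀ hp hkj]; linarith
    have j1 : (j : ℝ) / k ≤ 1 := by rw [div_le_one k0]; exact jk.le
    calc 6 * (j / k) * (d j / HH d j (k + 1)) ≤ 6 * 1 * (8 / (k - j)) := by gcongr
      _ = _ := by ring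
  · have a1 := HH_ge_mul G B hj (show j ≤ 2 * j by omega) (i := 2 * j) (by omega)
    have a2 := G.HH_mono hj (show 2 * j ≤ k + 1 by omega)
    have a3 := B.d8 hj (show j ≤ 2 * j by omega) le_rfl
    have a4 : (j : ℝ) * (d j / 8) ≤ HH d j (k + 1) := by
      refine le_trans ?_ (a1.trans a2)
      push_cast
      rw [two_mul, add_sub_cancel_right]
      gcongr
    have : d j / HH d j (k + 1) ≤ 8 / j := by
      rw [div_le_div_iff₀ hp j0]; linarith
    calc 6 * (j / k) * (d j / HH d j (k + 1)) ≤ 6 * (j / k) * (8 / j) := by gcongr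
      _ = 48 / k := by field_simp; norm_num
      _ ≤ _ := by gcongr; linarith

lemma n2 (G : HarmHyp q p1 p2 d K c) (B : LH L d K)
    {j k : ℕ} (hj : K ≤ j) (h : j ^ 2 ≤ k) : rr d j k ≤ 4 * (d k / TT d k) := by
  have hK := B.hK
  have hjj : j ≤ j ^ 2 := by nlinarith
  have hp := G.HH_pos hj (show j < k + 1 by omega)
  refine mul_le_mul_of_nonneg_right ?_ 
    (div_nonneg (B.dpos k (by omega)).le (G.TT_pos (by omega)).le)
  rw [div_le_iff₀ hp]
  have a1 := G.HH_mono hj (show j ^ 2 ≤ k + 1 by omega)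
  have a2 := G.TT_HH (d := d) hjj
  have Tp := G.TT_pos (show K ≤ j ^ 2 by omega)
  have a3 : TT d (j ^ 2) / 3 ≤ HH d j (j ^ 2) := by
    calc TT d (j ^ 2) / 3 ≤ TT d (j ^ 2) / 2 * Real.log 2 := by
          have := Real.log_two_gt_d9
          nlinarith
      _ = TT d (j ^ 2) / 2 * (Real.log (Real.log ((j ^ 2 : ℕ) : ℝ)) - Real.log (Real.log j)) := by
          congr 1
          have : 0 < Real.log j := Real.log_pos (by exact_mod_cast (by omega : 1 < j))
          push_cast
          rw [Real.log_pow, Real.log_mul (by norm_num) this.ne']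
          push_cast
          ring
      _ ≤ TT d (j ^ 2) / 2 * ∑ i ∈ Finset.Ico j (j ^ 2), 1 / (i * Real.log i) := by
          have := loglog_tele (by omega) hjj
          gcongr
      _ = ∑ i ∈ Finset.Ico j (j ^ 2), TT d (j ^ 2) / 2 * (1 / (i * Real.log i)) := by
          rw [Finset.mul_sum]
      _ ≤ HH d j (j ^ 2) := by
          refine Finset.sum_le_sum fun i hi => ?_
          rw [Finset.mem_Ico] at hi
          have b1 := phi_lower G B (n := i) (by omega)
          have b2 := G.TT_anti (show K ≤ i + 1 by omega) (show i + 1 ≤ j ^ 2 by omega)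
          have b3 := B.Ll i (by omega)
          have b4 := B.L1 i (by omega)
          have b5 := B.dpos i (by omega)
          have i0 : (0 : ℝ) < i := by exact_mod_cast (by omega : 0 < i)
          have : (0 : ℝ) < i * Real.log i := mul_pos i0 (by linarith)
          rw [mul_one_div, div_le_iff₀ this]
          calc TT d (j ^ 2) / 2 ≤ i * L i * d i := by linarith
            _ ≤ i * Real.log i * d i := by gcongr
            _ = _ := by ring
  linarith

lemma n3 (G : HarmHyp q p1 p2 d K c) (B : LH L d K)
    {j k : ℕ} (hj : K ≤ j) (h : j < k) (h2 : k ≤ 2 * j) : 1 / (16 * ((k : ℝ) - j)) ≤ rr d j k := by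
  have hp := G.HH_pos hj (show j < k + 1 by omega)
  have a1 := HH_le_mul G B hj (show j ≤ k + 1 by omega)
  have a2 := B.d8 hj h.le h2
  have dj := B.dpos j hj
  have Tk := G.TT_pos (show K ≤ k by omega)
  have jk : (j : ℝ) + 1 ≤ k := by exact_mod_cast h
  have e : rr d j k = (TT d j / TT d k) * (d k / HH d j (k + 1)) := by
    unfold rr; field_simp
  have a3 : 1 ≤ TT d j / TT d k := by
    rw [one_le_div Tk]; exact G.TT_anti hj h.le
  have dk := B.dpos k (by omega)
  have a4 : 1 / (16 * ((k : ℝ) - j)) ≤ d k / HH d j (k + 1) := by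
    rw [div_le_div_iff₀ (by linarith) hp]
    push_cast at a1
    have : ((k : ℝ) + 1 - j) * d j ≤ (2 * (k - j)) * (8 * d k) := by
      refine mul_le_mul ?_ ?_ dj.le ?_ <;> linarith
    linarith
  rw [e]
  calc _ ≤ d k / HH d j (k + 1) := a4
    _ = 1 * (d k / HH d j (k + 1)) := by ring
    _ ≤ _ := by gcongr

end

end

section

/-- backward iteration, distance `i` back from `N+1` -/
def xiB (a b r : ℕ → ℝ) (N n : ℕ) : ℕ → ℝ
  | 0 => r n
  | i + 1 => a n + b n / xiB a b r N (n + 1) i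

lemma xi_step {a b r e : ℕ → ℝ} {K : ℕ} {θ δ : ℝ} (h0 : 0 < θ) (h1 : θ < 1) (hδ : δ < 1)
    (hb : ∀ n, K ≤ n → 0 < b n) (hbt : ∀ n, K ≤ n → b n ≤ θ * (1 - δ))
    (hr1 : ∀ n, K ≤ n → 1 ≤ r n) (hr : ∀ n, K ≤ n → r n = a n + b n / r n)
    (he : ∀ n, K ≤ n → e (n + 1) ≤ e n)
    (hre : ∀ n, K ≤ n → |r (n + 1) - r n| ≤ e n)
    (hed : ∀ n, K ≤ n → θ / (1 - θ) * e n ≤ δ) {n : ℕ} (hn : K ≤ n) {x : ℝ} 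
    (hx : |x - r (n + 1)| ≤ θ / (1 - θ) * e (n + 1)) :
    |a n + b n / x - r n| ≤ θ / (1 - θ) * e n := by
  have t : 0 < 1 - θ := by linarith
  have x1 : 1 - δ ≤ x := by
    have a1 := hed (n + 1) (by omega)
    have a2 := hr1 (n + 1) (by omega)
    have := (abs_le.1 hx).1
    linarith
  have x0 : 0 < x := by linarith
  have rn := hr1 n hn
  have e1 : a n + b n / x - r n = b n / (x * r n) * (r n - x) := by
    have : a n = r n - b n / r n := by linarith [hr n hn]
    rw [this]
    field_simp
    ring
  rw [e1, abs_mul, abs_of_nonneg (div_nonneg (hb n hn).le (by positivity))]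
  have f1 : b n / (x * r n) ≤ θ := by
    rw [div_le_iff₀ (by positivity)]
    refine (hbt n hn).trans ?_
    have : (1 - δ) ≤ x * r n := by nlinarith
    gcongr
  have f2 : |r n - x| ≤ e n + θ / (1 - θ) * e n := by
    have e2 : r n - x = -(r (n + 1) - r n) - (x - r (n + 1)) := by ring
    rw [e2]
    refine (abs_sub _ _).trans ?_
    rw [abs_neg]
    have := he n hn
    refine add_le_add (hre n hn) (hx.trans ?_)
    gcongr
  calc _ ≤ θ * (e n + θ / (1 - θ) * e n) := by gcongr
    _ = _ := by field_simp; ring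

lemma exists_xi {a b r e : ℕ → ℝ} {K : ℕ} {θ δ : ℝ} (h0 : 0 < θ) (h1 : θ < 1) (hδ : δ < 1)
    (hb : ∀ n, K ≤ n → 0 < b n) (hbt : ∀ n, K ≤ n → b n ≤ θ * (1 - δ))
    (hr1 : ∀ n, K ≤ n → 1 ≤ r n) (hr : ∀ n, K ≤ n → r n = a n + b n / r n)
    (he : ∀ n, K ≤ n → e (n + 1) ≤ e n)
    (hre : ∀ n, K ≤ n → |r (n + 1) - r n| ≤ e n)
    (hed : ∀ n, K ≤ n → θ / (1 - θ) * e n ≤ δ) :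
    ∃ x : ℕ → ℝ, ∀ n, K ≤ n → x n = a n + b n / x (n + 1) ∧ |x n - r n| ≤ θ / (1 - θ) * e n := by
  have t : 0 < 1 - θ := by linarith
  have hB : ∀ i n N, K ≤ n → |xiB a b r N n i - r n| ≤ θ / (1 - θ) * e n := by
    intro i
    induction i with
    | zero =>
      intro n N hn
      have : 0 ≤ e n := (abs_nonneg _).trans (hre n hn)
      simp only [xiB, sub_self, abs_zero]
      positivity
    | succ i ih =>
      intro n N hn
      exact xi_step h0 h1 hδ hb hbt hr1 hr he hre hed hn (ih (n + 1) N (by omega))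
  let U : Ultrafilter ℕ := hyperfilter ℕ
  let X : ℕ → ℕ → ℝ := fun N n => xiB a b r N n (N - n)
  have hX : ∀ n, K ≤ n → ∃ l, l ∈ Metric.closedBall (r n) (θ / (1 - θ) * e n) ∧ 
      Tendsto (fun N => X N n) U (𝓝 l) := by
    intro n hn
    have hc := isCompact_closedBall (r n) (θ / (1 - θ) * e n)
    obtain ⟨l, hl, hl2⟩ := hc.ultrafilter_le_nhds (U.map fun N => X N n) (by
      simp only [Ultrafilter.coe_map, le_principal_iff, mem_map]
      refine Filter.univ_mem' fun N => ?_
      simp only [Set.mem_preimage, Metric.mem_closedBall, Real.dist_eq]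
      exact hB _ _ _ hn)
    exact ⟨l, hl, hl2⟩
  choose! x hx1 hx2 using hX
  refine ⟨x, fun n hn => ?_⟩
  have hball : ∀ n, K ≤ n → |x n - r n| ≤ θ / (1 - θ) * e n := by
    intro n hn
    have := hx1 n hn
    rwa [Metric.mem_closedBall, Real.dist_eq] at this
  refine ⟨?_, hball n hn⟩
  have x0 : x (n + 1) ≠ 0 := by
    have a1 := hed (n + 1) (by omega)
    have a2 := hr1 (n + 1) (by omega)
    have := (abs_le.1 (hball (n + 1) (by omega))).1
    intro h
    rw [h] at this
    linarith
  have lim1 := hx2 n hn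
  have lim2 : Tendsto (fun N => a n + b n / X N (n + 1)) U (𝓝 (a n + b n / x (n + 1))) :=
    (tendsto_const_nhds.div (hx2 (n + 1) (by omega)) x0).const_add _
  refine tendsto_nhds_unique lim1 (lim2.congr' ?_)
  have hU : (U : Filter ℕ) ≤ atTop := by
    rw [← Nat.cofinite_eq_atTop]; exact hyperfilter_le_cofinite
  refine hU ?_
  filter_upwards [eventually_gt_atTop n] with N hN
  have : N - n = (N - (n + 1)) + 1 := by omega
  simp only [X]
  rw [this, xiB]


end

section

/-- `L_n = (log log n)^β` -/
def LL (β : ℝ) (n : ℕ) : ℝ := Real.log (Real.log n) ^ β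

lemma exp_le_lin {y : ℝ} (h0 : 0 ≤ y) (h1 : y ≤ 1) : Real.exp y ≤ 1 + 2 * y := by
  have := Real.abs_exp_sub_one_le (x := y) (by rw [abs_of_nonneg h0]; exact h1)
  rw [abs_of_nonneg h0] at this
  linarith [(abs_le.1 this).2]

lemma tendsto_logn : Tendsto (fun n : ℕ => Real.log n) atTop atTop :=
  Real.tendsto_log_atTop.comp tendsto_natCast_atTop_atTop

lemma LL_one {β : ℝ} (hβ : 0 ≤ β) : ∀ᶠ n in atTop, 1 ≤ LL β n := by
  filter_upwards [tendsto_loglog.eventually_ge_atTop 1] with n h1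
  exact Real.one_le_rpow h1 hβ

lemma LL_mono {β : ℝ} (hβ : 0 ≤ β) : ∀ᶠ n in atTop, LL β n ≤ LL β (n + 1) := by
  filter_upwards [tendsto_loglog.eventually_ge_atTop 1, eventually_ge_atTop 3] with n h1 h3
  have h3 : (3 : ℝ) ≤ n := by exact_mod_cast h3
  refine Real.rpow_le_rpow (by linarith) ?_ hβ
  refine Real.log_le_log (Real.log_pos (by linarith)) (Real.log_le_log (by linarith) ?_)
  push_cast
  linarith

lemma LL_inc {β : ℝ} (hβ : 0 ≤ β) : 
    ∀ᶠ n : ℕ in atTop, LL β (n + 1) ≤ LL β n * (1 + 2 * β / Real.log n / n) := by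
  filter_upwards [tendsto_loglog.eventually_ge_atTop 1, eventually_ge_atTop 3,
    tendsto_logn.eventually_ge_atTop (β + 1)] with n h1 h3 h4
  have hs := loglog_step h3
  have h3 : (3 : ℝ) ≤ n := by exact_mod_cast h3
  unfold LL
  set g := Real.log (Real.log n)
  set g' := Real.log (Real.log ((n + 1 : ℕ) : ℝ))
  have lp : 0 < Real.log n := by linarith
  have g'0 : 0 ≤ g' := by
    have : g ≤ g' := by
      refine Real.log_le_log lp (Real.log_le_log (by linarith) ?_)
      push_cast
      linarith
    linarith
  set x := 1 / (n * Real.log n) with hx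
  have x0 : 0 ≤ x := by positivity
  have e1 : g' ≤ g * Real.exp x := by
    have : 1 + x ≤ Real.exp x := by linarith [Real.add_one_le_exp x]
    nlinarith
  have bx : β * x ≤ 1 := by
    rw [hx, mul_one_div, div_le_one (by positivity)]
    nlinarith
  calc g' ^ β ≤ (g * Real.exp x) ^ β := Real.rpow_le_rpow g'0 e1 hβ
    _ = g ^ β * Real.exp (β * x) := by
      rw [Real.mul_rpow (by linarith) (Real.exp_pos _).le, ← Real.exp_mul, mul_comm x]
    _ ≤ g ^ β * (1 + 2 * (β * x)) := by
      have := exp_le_lin (mul_nonneg hβ x0) bx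
      have : 0 ≤ g ^ β := Real.rpow_nonneg (by linarith) _
      gcongr
    _ = _ := by rw [hx]; field_simp

lemma LL_small (β : ℝ) : Tendsto (fun n : ℕ => LL β n / Real.log n) atTop (𝓝 0) := by
  have h := (isLittleO_log_rpow_rpow_atTop β (s := 1) one_pos).tendsto_div_nhds_zero
  have := h.comp tendsto_logn
  refine this.congr fun n => ?_
  simp [LL]

lemma LL_le_log (β : ℝ) : ∀ᶠ n : ℕ in atTop, LL β n ≤ Real.log n := by
  filter_upwards [(LL_small β).eventually_le_const one_pos, tendsto_logn.eventually_gt_atTop 0] 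
    with n h1 h2
  rwa [div_le_one h2] at h1

lemma LL_div_n (β : ℝ) : Tendsto (fun n : ℕ => LL β n / n) atTop (𝓝 0) := by
  have h := (Real.isLittleO_log_id_atTop).tendsto_div_nhds_zero
  have h2 := h.comp tendsto_natCast_atTop_atTop
  have h3 := (LL_small β).mul h2
  rw [zero_mul] at h3
  refine h3.congr' ?_
  filter_upwards [tendsto_logn.eventually_gt_atTop 0] with n hn
  simp only [Function.comp, id]
  field_simp

/-- core estimates on `v_n = 1/n + 1/(n L_n)` -/
lemma v_diff {n l l' η : ℝ} (hn : 1 ≤ n) (hl : 1 ≤ l) (hll : l ≤ l') (hη : η ≤ 1)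
    (hinc : l' ≤ l * (1 + η / n)) :
    |(1 / (n + 1) + 1 / ((n + 1) * l')) - (1 / n + 1 / (n * l))| ≤ 3 / n ^ 2 := by
  have n0 : 0 < n := by linarith
  have l0 : 0 < l := by linarith
  have l'0 : 0 < l' := by linarith
  have a1 : 1 / (n + 1) ≤ 1 / n := by gcongr; linarith
  have a2 : 1 / ((n + 1) * l') ≤ 1 / (n * l) := by
    gcongr; linarith
  rw [abs_sub_comm, abs_of_nonneg (by linarith)]
  have a3 : 1 / n - 1 / (n + 1) ≤ 1 / n ^ 2 := by
    rw [div_sub_div _ _ n0.ne' (by positivity), div_le_div_iff₀ (by positivity) (by positivity)]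
    nlinarith
  have a4 : l' ≤ l * ((n + 1) / n) := by
    refine hinc.trans ?_
    have : 1 + η / n ≤ (n + 1) / n := by
      rw [add_div, div_self n0.ne']
      gcongr
    gcongr
  have a5 : n / ((n + 1) ^ 2 * l) ≤ 1 / ((n + 1) * l') := by
    rw [div_le_div_iff₀ (by positivity) (by positivity)]
    calc n * ((n + 1) * l') ≤ n * ((n + 1) * (l * ((n + 1) / n))) := by gcongr
      _ = _ := by field_simp
  have a6 : 1 / (n * l) - n / ((n + 1) ^ 2 * l) ≤ 2 / n ^ 2 := by
    have : 1 / (n * l) - n / ((n + 1) ^ 2 * l) = (2 * n + 1) / (n * (n + 1) ^ 2) / l := by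
      field_simp
      ring
    rw [this]
    refine (div_le_self (by positivity) hl).trans ?_
    rw [div_le_div_iff₀ (by positivity) (by positivity)]
    nlinarith
  have : 3 / n ^ 2 = 1 / n ^ 2 + 2 / n ^ 2 := by ring
  linarith

lemma ph_core {n l l' η C x : ℝ} (hn : 64 ≤ n) (hl : 1 ≤ l) (hll : l ≤ l') (hη0 : 0 ≤ η) (hη : η ≤ 1)
    (hinc : l' ≤ l * (1 + η / n)) (hC : 0 ≤ C)
    (hx : |x - (1 + (1 / (n + 1) + 1 / ((n + 1) * l')))| ≤ C / (n + 1) ^ 2)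
    (h1 : (C + 1) * (l / n) ≤ 1 / 8) (h2 : l * η ≤ 1 / 16) :
    1 / 2 ≤ n * l * x - (n + 1) * l' ∧ n * l * x - (n + 1) * l' ≤ 2 := by
  have n0 : 0 < n := by linarith
  have l0 : 0 < l := by linarith
  have l'0 : 0 < l' := by linarith
  obtain ⟨b1, b2⟩ := abs_le.1 hx
  have c1 : n * l * (C / (n + 1) ^ 2) ≤ C * (l / n) := by
    have : n * l * (C / (n + 1) ^ 2) = C * l * (n / (n + 1) ^ 2) := by field_simp
    rw [this, mul_div_assoc', mul_div_assoc']
    rw [div_le_div_iff₀ (by positivity) n0]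
    have : n * n ≤ (n + 1) ^ 2 := by nlinarith
    calc C * l * n * n = C * l * (n * n) := by ring
      _ ≤ _ := by gcongr
  have nl : 0 < n * l := by positivity
  have u1 := mul_le_mul_of_nonneg_left b2 nl.le
  have u2 := mul_le_mul_of_nonneg_left b1 nl.le
  have e1 : n * l * (1 + (1 / (n + 1) + 1 / ((n + 1) * l'))) = 
      (n + 1) * l - l / (n + 1) + n * l / ((n + 1) * l') := by
    field_simp
    ring
  have q0 : 0 ≤ l / (n + 1) := by positivity
  have q1 : l / (n + 1) ≤ l / n := by gcongr; linarith
  have q2 : n * l / ((n + 1) * l') ≤ 1 := by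
    rw [div_le_one (by positivity)]
    gcongr
    linarith
  have q3 : 15 / 16 ≤ n * l / ((n + 1) * l') := by
    rw [le_div_iff₀ (by positivity)]
    have : (n + 1) * l' ≤ (n + 1) * (l * (1 + 1 / n)) := by
      refine mul_le_mul_of_nonneg_left (hinc.trans ?_) (by positivity)
      gcongr
    have e : (n + 1) * (l * (1 + 1 / n)) = l * ((n + 1) ^ 2 / n) := by
      field_simp
    have e' : (n + 1) ^ 2 / n ≤ n + 3 := by
      rw [div_le_iff₀ n0]
      nlinarith
    have : (n + 1) * l' ≤ l * (n + 3) := by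
      rw [e] at this
      refine this.trans ?_
      gcongr
    nlinarith
  have q4 : (n + 1) * l' ≤ (n + 1) * l + 2 * (l * η) := by
    have : (n + 1) * l' ≤ (n + 1) * (l * (1 + η / n)) := by gcongr
    have e : (n + 1) * (l * (1 + η / n)) = (n + 1) * l + (n + 1) / n * (l * η) := by
      field_simp
    have e' : (n + 1) / n ≤ 2 := by
      rw [div_le_iff₀ n0]; linarith
    have : (n + 1) / n * (l * η) ≤ 2 * (l * η) := by gcongr
    linarith
  have q5 : (n + 1) * l ≤ (n + 1) * l' := by gcongr
  have q6 : 0 ≤ C * (l / n) := by positivity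
  constructor <;> nlinarith

section
variable {q p1 p2 : ℕ → ℝ}

lemma rho_eq {k : ℕ} (hk : 0 < rho q p1 p2 k) (hq : 0 < q k) (hp2 : 0 < p2 k) :
    rho q p1 p2 k = (p1 k + p2 k) / q k + (p2 k / q k) / rho q p1 p2 k := by
  have : rho q p1 p2 k ^ 2 = (p1 k + p2 k) / q k * rho q p1 p2 k + p2 k / q k := by
    unfold rho
    have hb : 0 < p2 k / q k := div_pos hp2 hq
    have := Real.sq_sqrt (show 0 ≤ ((p1 k + p2 k) / q k) ^ 2 + 4 * (p2 k / q k) by positivity)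
    nlinarith
  field_simp at this ⊢
  linarith

lemma rseq_eq {β : ℝ} {n : ℕ} (hn : 4 ≤ n) : 3 * rseq β n = 1 / n + 1 / (n * LL β n) := by
  rw [rseq, if_pos hn, LL]
  ring

theorem exists_d (H : WalkHyp q p1 p2) (a b : ℝ) (ha : 0 < a) (hb : 0 < b)
    (hCa : Tendsto (fun k => (p1 k + p2 k) / q k) atTop (𝓝 a))
    (hCb : Tendsto (fun k => p2 k / q k) atTop (𝓝 b))
    (β : ℝ) (hβ : 0 ≤ β)
    (hrho : (fun k => rho q p1 p2 k - (1 + 3 * rseq β k))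
      =O[atTop] fun k => rseq β k ^ 2) :
    ∃ d K c, HarmHyp q p1 p2 d K c ∧ LH (LL β) d K := by
  obtain ⟨C, C0, hC⟩ := hrho.exists_pos
  -- estimate of rho
  let v : ℕ → ℝ := fun n => 1 / n + 1 / (n * LL β n)
  have hv2 : ∀ᶠ n : ℕ in atTop, v n ≤ 2 / n := by
    filter_upwards [LL_one hβ, eventually_ge_atTop 4] with n h1 h4
    have n0 : (0 : ℝ) < n := by exact_mod_cast (by omega : 0 < n)
    have : 1 / (n * LL β n) ≤ 1 / (n : ℝ) := by
      gcongr
      nlinarith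
    simp only [v]
    have : (2 : ℝ) / n = 1 / n + 1 / n := by ring
    linarith
  have hv1 : ∀ᶠ n : ℕ in atTop, 1 / (n : ℝ) ≤ v n := by
    filter_upwards [LL_one hβ] with n h1
    simp only [v]
    have : 0 ≤ 1 / (n * LL β n) := by positivity
    linarith
  have hr : ∀ᶠ n : ℕ in atTop, |rho q p1 p2 n - (1 + v n)| ≤ C / (n : ℝ) ^ 2 := by
    filter_upwards [hC.bound, hv2, hv1, eventually_ge_atTop 4] with n h1 h2 h2' h4
    have n0 : (0 : ℝ) < n := by exact_mod_cast (by omega : 0 < n)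
    have e : 3 * rseq β n = v n := rseq_eq h4
    rw [e, Real.norm_eq_abs, Real.norm_eq_abs, abs_of_nonneg (sq_nonneg (rseq β n))] at h1
    refine h1.trans ?_
    have h3 : rseq β n ≤ 1 / n := by
      have : (2 : ℝ) / n = 2 * (1 / n) := by ring
      have : 0 < 1 / (n : ℝ) := by positivity
      linarith
    have h5 : 0 ≤ rseq β n := by
      have : 0 ≤ 1 / (n : ℝ) := by positivity
      linarith
    have : rseq β n ^ 2 ≤ (1 / n : ℝ) ^ 2 := by gcongr
    calc C * rseq β n ^ 2 ≤ C * (1 / n : ℝ) ^ 2 := by gcongr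
      _ = _ := by field_simp
  have tn : Tendsto (fun n : ℕ => (n : ℝ)) atTop atTop := tendsto_natCast_atTop_atTop
  have t1 : ∀ D : ℝ, Tendsto (fun n : ℕ => D / (n : ℝ)) atTop (𝓝 0) := fun D => 
    tendsto_const_nhds.div_atTop tn
  have t2 : ∀ D : ℝ, Tendsto (fun n : ℕ => D / (n : ℝ) ^ 2) atTop (𝓝 0) := fun D => 
    tendsto_const_nhds.div_atTop ((tendsto_pow_atTop two_ne_zero).comp tn)
  have vlim : Tendsto v atTop (𝓝 0) := by
    refine tendsto_of_tendsto_of_tendsto_of_le_of_le' (t1 1) (t1 2) hv1 hv2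
  have rlim : Tendsto (rho q p1 p2) atTop (𝓝 1) := by
    have h1 : Tendsto (fun n => rho q p1 p2 n - (1 + v n)) atTop (𝓝 0) :=
      squeeze_zero_norm' (by simpa [Real.norm_eq_abs] using hr) (t2 C)
    have := h1.add (vlim.const_add 1)
    simpa using this
  have hr1 : ∀ᶠ n : ℕ in atTop, 1 ≤ rho q p1 p2 n := by
    filter_upwards [hr, hv1, tn.eventually_ge_atTop C, eventually_ge_atTop 1] with n h1 h2 h3 h4
    have n0 : (0 : ℝ) < n := by exact_mod_cast (by omega : 0 < n)
    have : C / (n : ℝ) ^ 2 ≤ 1 / n := by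
      rw [div_le_div_iff₀ (by positivity) n0]
      nlinarith
    linarith [(abs_le.1 h1).1]
  have hreq : ∀ᶠ n : ℕ in atTop, rho q p1 p2 n = 
      (p1 n + p2 n) / q n + (p2 n / q n) / rho q p1 p2 n := by
    filter_upwards [hr1, eventually_ge_atTop 2] with n h1 h2
    exact rho_eq (by linarith) (H.hq n h2) (H.hp2 n h2)
  have hab : 1 = a + b / 1 := 
    tendsto_nhds_unique (rlim.congr' hreq) (hCa.add (hCb.div rlim one_ne_zero))
  rw [div_one] at hab
  have b1 : b < 1 := by linarith
  -- increments
  have ηlim : Tendsto (fun n : ℕ => 2 * β / Real.log n) atTop (𝓝 0) := 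
    tendsto_const_nhds.div_atTop tendsto_logn
  have hvd : ∀ᶠ n : ℕ in atTop, |v (n + 1) - v n| ≤ 3 / (n : ℝ) ^ 2 := by
    filter_upwards [LL_one hβ, LL_mono hβ, LL_inc hβ, ηlim.eventually_le_const one_pos,
      eventually_ge_atTop 1] with n h1 h2 h3 h4 h5
    have := v_diff (n := n) (by exact_mod_cast h5) h1 h2 h4 h3
    simp only [v]
    push_cast
    exact this
  have shift : ∀ {P : ℕ → Prop}, (∀ᶠ n in atTop, P n) → ∀ᶠ n in atTop, P (n + 1) := fun h => 
    (tendsto_add_atTop_nat 1).eventually h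
  have hrd : ∀ᶠ n : ℕ in atTop, |rho q p1 p2 (n + 1) - rho q p1 p2 n| ≤ 
      (2 * C + 3) / (n : ℝ) ^ 2 := by
    filter_upwards [hr, shift hr, hvd, eventually_ge_atTop 1] with n h1 h2 h3 h4
    have n0 : (0 : ℝ) < n := by exact_mod_cast (by omega : 0 < n)
    have h2' : |rho q p1 p2 (n + 1) - (1 + v (n + 1))| ≤ C / (n : ℝ) ^ 2 := by
      refine h2.trans ?_
      push_cast
      gcongr
      linarith
    have e : (2 * C + 3) / (n : ℝ) ^ 2 = C / (n : ℝ) ^ 2 + C / (n : ℝ) ^ 2 + 3 / (n : ℝ) ^ 2 := by ring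
    rw [e]
    rw [abs_le] at *
    constructor <;> linarith [h1.1, h1.2, h2'.1, h2'.2, h3.1, h3.2]
  -- choose theta, delta
  obtain ⟨θ, θ1, θ2⟩ := exists_between b1
  have θ0 : 0 < θ := by linarith
  obtain ⟨s, s1, s2⟩ := exists_between (show b / θ < 1 from (div_lt_one θ0).2 θ1)
  have bs : b < θ * s := by rw [div_lt_iff₀ θ0] at s1; linarith
  have s0 : 0 < s := lt_trans (by positivity) s1
  set C3 := θ / (1 - θ) * (2 * C + 3) with hC3
  have C30 : 0 < C3 := by
    have : 0 < 1 - θ := by linarith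
    positivity
  set C4 := C + C3 with hC4
  -- everything eventually
  have ev : ∀ᶠ n : ℕ in atTop, 64 ≤ n ∧ 1 ≤ LL β n ∧ LL β n ≤ LL β (n + 1) ∧ 
      LL β (n + 1) ≤ LL β n * (1 + 2 * β / Real.log n / n) ∧ LL β n ≤ Real.log n ∧
      2 * β / Real.log n ≤ 1 ∧ LL β n * (2 * β / Real.log n) ≤ 1 / 16 ∧ 
      (C4 + 1) * (LL β n / n) ≤ 1 / 8 ∧ C4 ≤ n := by
    have w1 : Tendsto (fun n : ℕ => LL β n * (2 * β / Real.log n)) atTop (𝓝 0) := by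
      have := (LL_small β).mul_const (2 * β)
      rw [zero_mul] at this
      exact this.congr fun n => by ring
    have w2 := (LL_div_n β).const_mul (C4 + 1)
    rw [mul_zero] at w2
    filter_upwards [eventually_ge_atTop 64, LL_one hβ, LL_mono hβ, LL_inc hβ, LL_le_log β,
      ηlim.eventually_le_const one_pos, w1.eventually_le_const (by norm_num : (0 : ℝ) < 1 / 16),
      w2.eventually_le_const (by norm_num : (0 : ℝ) < 1 / 8), tn.eventually_ge_atTop C4] 
      with n h1 h2 h3 h4 h5 h6 h7 h8 h9
    exact ⟨h1, h2, h3, h4, h5, h6, h7, h8, h9⟩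
  have ev2 : ∀ᶠ n : ℕ in atTop, p2 n / q n ≤ θ * s ∧ C3 / (n : ℝ) ^ 2 ≤ 1 - s ∧ 
      b / 2 ≤ p2 n / q n ∧ (p1 n + p2 n) / q n ≤ a + 1 := by
    filter_upwards [hCb.eventually_le_const bs, (t2 C3).eventually_le_const (sub_pos.2 s2),
      hCb.eventually_const_le (half_lt_self hb), hCa.eventually_le_const (lt_add_one a)] 
      with n h1 h2 h3 h4
    exact ⟨h1, h2, h3, h4⟩
  obtain ⟨K, hK⟩ := eventually_atTop.1 (ev.and (ev2.and (hr.and (hr1.and (hreq.and (hrd.and 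
    (hv1.and hv2)))))))
  have K32 : 64 ≤ K := (hK K le_rfl).1.1
  have npos : ∀ n : ℕ, K ≤ n → (0 : ℝ) < n := fun n hn => by exact_mod_cast (by omega : 0 < n)
  obtain ⟨x, hx⟩ := exists_xi (a := fun n => (p1 n + p2 n) / q n) (b := fun n => p2 n / q n)
    (r := rho q p1 p2) (e := fun n => (2 * C + 3) / (n : ℝ) ^ 2) (K := K) (δ := 1 - s) θ0 θ2 
    (by linarith)
    (fun n hn => div_pos (H.hp2 n (by omega)) (H.hq n (by omega)))
    (fun n hn => by rw [_root_.sub_sub_cancel]; exact (hK n hn).2.1.1)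
    (fun n hn => (hK n hn).2.2.2.1) (fun n hn => (hK n hn).2.2.2.2.1)
    (fun n hn => by
      have := npos n hn
      push_cast
      gcongr
      linarith)
    (fun n hn => (hK n hn).2.2.2.2.2.1)
    (fun n hn => by rw [← mul_div_assoc]; exact (hK n hn).2.1.2.1)
  have hx4 : ∀ n, K ≤ n → |x n - (1 + v n)| ≤ C4 / (n : ℝ) ^ 2 := by
    intro n hn
    have h1 := (hx n hn).2
    rw [← mul_div_assoc, ← hC3] at h1
    have h2 := (hK n hn).2.2.1
    rw [hC4, add_div]
    rw [abs_le] at *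
    constructor <;> linarith [h1.1, h1.2, h2.1, h2.2]
  have C40 : ∀ n, K ≤ n → C4 / (n : ℝ) ^ 2 ≤ 1 / n := by
    intro n hn
    have n0 := npos n hn
    have := (hK n hn).1.2.2.2.2.2.2.2.2
    rw [div_le_div_iff₀ (by positivity) n0]
    nlinarith
  have x1 : ∀ n, K ≤ n → 1 ≤ x n := by
    intro n hn
    linarith [(abs_le.1 (hx4 n hn)).1, C40 n hn, (hK n hn).2.2.2.2.2.2.1]
  have x3 : ∀ n, K ≤ n → x n ≤ 1 + 3 / n := by
    intro n hn
    have : (3 : ℝ) / n = 1 / n + 2 / n := by ring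
    linarith [(abs_le.1 (hx4 n hn)).2, C40 n hn, (hK n hn).2.2.2.2.2.2.2]
  let d : ℕ → ℝ := fun n => ∏ i ∈ Finset.Ico K n, (x (i + 1))⁻¹
  have dpos : ∀ n, 0 < d n := by
    intro n
    refine Finset.prod_pos fun i hi => ?_
    have := x1 (i + 1) (by have := (Finset.mem_Ico.1 hi).1; omega)
    positivity
  have dstep : ∀ n, K ≤ n → d n = x (n + 1) * d (n + 1) := by
    intro n hn
    have := x1 (n + 1) (by omega)
    simp only [d]
    rw [Finset.prod_Ico_succ_top hn]
    field_simp
  have B : LH (LL β) d K := by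
    refine ⟨by omega, fun n hn => (hK n hn).1.2.1, fun n hn => (hK n hn).1.2.2.1,
      fun n hn => (hK n hn).1.2.2.2.2.1, fun n _ => dpos n, fun n hn => ?_, fun n hn => ?_, 
      fun n hn => ?_, fun n hn => ?_⟩
    · rw [dstep n hn]
      nlinarith [x1 (n + 1) (by omega), dpos (n + 1)]
    · rw [dstep n hn]
      have := x3 (n + 1) (by omega)
      push_cast at this
      exact mul_le_mul_of_nonneg_right this (dpos _).le
    all_goals
      obtain ⟨⟨k1, k2, k3, k4, k5, k6, k7, k8, k9⟩, -⟩ := hK n hn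
      have := hx4 (n + 1) (by omega)
      simp only [v] at this
      push_cast at this
      have l0 : 0 ≤ Real.log n := by linarith
      have := ph_core (n := n) (l := LL β n) (l' := LL β (n + 1)) (x := x (n + 1)) (C := C4)
        (by exact_mod_cast k1) k2 k3 (by positivity) k6 k4 (by positivity) this k8 k7
      have dp := dpos (n + 1)
      rw [dstep n hn]
    · nlinarith [this.1]
    · nlinarith [this.2]
  have qe : ∀ n, K ≤ n → q n = 1 / (1 + (p1 n + p2 n) / q n) := by
    intro n hn
    have h1 := H.hsum n (by omega)
    have h2 := H.hq n (by omega)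
    have h3 : (1 + (p1 n + p2 n) / q n) = 1 / q n := by
      field_simp
      linarith
    rw [h3, one_div_one_div]
  have ql : ∀ n, K ≤ n → 1 / (a + 2) ≤ q n := by
    intro n hn
    rw [qe n hn]
    have h2 := H.hq n (by omega)
    have h3 := H.hp2 n (by omega)
    have h4 := H.hp1 n (by omega)
    have := (hK n hn).2.1.2.2.2
    have h5 : 0 ≤ (p1 n + p2 n) / q n := by positivity
    exact one_div_le_one_div_of_le (by linarith) (by linarith)
  have c0 : 0 < min (1 / (a + 2)) (b / 2 * (1 / (a + 2))) := by
    refine lt_min ?_ ?_ <;> positivity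
  refine ⟨d, K, min (1 / (a + 2)) (b / 2 * (1 / (a + 2))), ⟨by omega, c0, fun n hn => ?_, 
    fun n hn => ?_, fun n _ => dpos n, B.summable, fun n hn => ?_⟩, B⟩
  · exact (min_le_left _ _).trans (ql n hn)
  · refine (min_le_right _ _).trans ?_
    have h2 := H.hq n (by omega)
    have h5 := (hK n hn).2.1.2.2.1
    have : p2 n = p2 n / q n * q n := by field_simp
    rw [this]
    have := ql n hn
    have h3 : 0 < 1 / (a + 2) := by positivity
    exact mul_le_mul h5 this h3.le (by linarith)
  · have e1 := dstep (n - 1) (by omega)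
    rw [show n - 1 + 1 = n by omega] at e1
    have e2 := dstep n hn.le
    have e3 := (hx n hn.le).1
    have h2 := H.hq n (by omega)
    have h6 := x1 (n + 1) (by omega)
    have e4 : d (n + 1) = d n / x (n + 1) := by
      rw [e2]; field_simp
    rw [e1, e4, e3]
    field_simp

end

end

section

lemma real_of_le {μ : Measure (ℕ → ℕ)} [IsProbabilityMeasure μ] {A B : Set (ℕ → ℕ)} {a : ℝ}
    (h : ENNReal.ofReal a * μ A ≤ μ B) : a * μ.real A ≤ μ.real B := by
  have := ENNReal.toReal_mono (measure_ne_top μ B) h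
  rw [ENNReal.toReal_mul] at this
  refine le_trans ?_ this
  refine mul_le_mul_of_nonneg_right ?_ measureReal_nonneg
  rw [ENNReal.toReal_ofReal']
  exact le_max_left _ _

lemma real_of_ge {μ : Measure (ℕ → ℕ)} [IsProbabilityMeasure μ] {A B : Set (ℕ → ℕ)} {a : ℝ}
    (ha : 0 ≤ a) (h : μ B ≤ ENNReal.ofReal a * μ A) : μ.real B ≤ a * μ.real A := by
  have := ENNReal.toReal_mono (ENNReal.mul_ne_top ENNReal.ofReal_ne_top (measure_ne_top μ A)) h
  rw [ENNReal.toReal_mul, ENNReal.toReal_ofReal ha] at this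
  exact this

lemma Fst_disj (M : ℕ) {i j : ℕ} (hi : M ≤ i) (hj : M ≤ j) (h : i ≠ j) : 
    Disjoint (Fst M i) (Fst M j) := by
  refine Set.disjoint_left.2 ?_
  rintro ω ⟨a1, a2⟩ ⟨b1, b2⟩
  rcases lt_or_gt_of_ne h with h | h
  · obtain ⟨n, hn⟩ := b2 i hi h
    exact a1 n hn
  · obtain ⟨n, hn⟩ := a2 j hj h
    exact b1 n hn

lemma sum_Fst_le {μ : Measure (ℕ → ℕ)} [IsProbabilityMeasure μ] (M N : ℕ) {A : Set (ℕ → ℕ)}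
    (hA : MeasurableSet A) :
    ∑ j ∈ Finset.Ico M N, μ.real (Fst M j ∩ A) ≤ 
      μ.real ((⋃ j ∈ Finset.Ico M N, Fst M j) ∩ A) := by
  rw [Set.iUnion₂_inter, measureReal_biUnion_finset]
  · intro i hi j hj h
    refine (Fst_disj M ?_ ?_ h).mono Set.inter_subset_left Set.inter_subset_left
    · exact (Finset.mem_Ico.1 hi).1
    · exact (Finset.mem_Ico.1 hj).1
  · exact fun j _ => (measurableSet_Fst M j).inter hA

/-- any cutpoint `k ≥ M` is preceded by a first one. -/
lemma Cut_subset_Fst {M k : ℕ} (h : M ≤ k) : Cut k ⊆ ⋃ j ∈ Finset.Ico M (k + 1), Fst M j := by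
  classical
  intro ω hω
  have ex : ∃ j, M ≤ j ∧ ω ∈ Cut j := ⟨k, h, hω⟩
  have hf := Nat.find_spec ex
  simp only [Set.mem_iUnion]
  refine ⟨Nat.find ex, Finset.mem_Ico.2 ⟨hf.1, ?_⟩, hf.2, ?_⟩
  · have := Nat.find_min' ex ⟨h, hω⟩
    omega
  · intro l hl hlt
    have := Nat.find_min ex hlt
    by_contra hc
    push Not at hc
    exact this ⟨hl, hc⟩

lemma harm_lower {j m : ℕ} (h : j + 4 ≤ m) : 
    Real.log ((m : ℝ) - j) - Real.log 4 ≤ ∑ k ∈ Finset.Ico (j + 4) m, 1 / ((k : ℝ) - j) := by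
  induction m, h using Nat.le_induction with
  | base => simp
  | succ m hm ih =>
    rw [Finset.sum_Ico_succ_top hm]
    have hm' : (j : ℝ) + 4 ≤ m := by exact_mod_cast hm
    have := log_sub_le (x := (m : ℝ) - j) (y := (m : ℝ) - j + 1) (by linarith) (by linarith)
    rw [add_sub_cancel_left] at this
    push_cast
    rw [show (m : ℝ) + 1 - j = m - j + 1 by ring]
    linarith

lemma harm_upper {j m : ℕ} (h : j + 2 ≤ m) : 
    ∑ k ∈ Finset.Ico (j + 1) m, 1 / ((k : ℝ) - j) ≤ 1 + Real.log ((m : ℝ) - 1 - j) := by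
  induction m, h using Nat.le_induction with
  | base =>
    rw [Finset.sum_Ico_succ_top (by omega)]
    have : (j : ℝ) + 2 - 1 - j = 1 := by ring
    simp [this]
  | succ m hm ih =>
    rw [Finset.sum_Ico_succ_top (by omega)]
    have hm' : (j : ℝ) + 2 ≤ m := by exact_mod_cast hm
    have := log_sub_le (x := (m : ℝ) - j) (y := (m : ℝ) - 1 - j) (by linarith) (by linarith)
    rw [show (m : ℝ) - 1 - j - (m - j) = -1 by ring, neg_div] at this
    push_cast
    rw [show (m : ℝ) + 1 - 1 - j = m - j by ring]
    linarith

section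
variable {q p1 p2 d L : ℕ → ℝ} {K : ℕ} {c : ℝ}

lemma rr_nonneg (G : HarmHyp q p1 p2 d K c) {j k : ℕ} (hj : K ≤ j) (hk : K ≤ k) : 
    0 ≤ rr d j k :=
  mul_nonneg (div_nonneg (G.TT_pos hj).le (G.HH_nonneg hj _)) 
    (div_nonneg (G.dpos k hk).le (G.TT_pos hk).le)

lemma block_bound (H : WalkHyp q p1 p2) (G : HarmHyp q p1 p2 d K c) (B : LH L d K)
    {μ : Measure (ℕ → ℕ)} [IsProbabilityMeasure μ] {x : ℕ} 
    (hμ : IsMarkovChain μ (transY q p1 p2) x) {M : ℕ} (hx : x < M) (hM : K ≤ M) :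
    μ.real (⋃ k ∈ Finset.Ico M (2 * M), Cut k) ≤ 576 / c ^ 3 / (Real.log M * L M) := by
  have hK := B.hK
  have M0 : (16 : ℝ) ≤ M := by exact_mod_cast hK.trans hM
  have c0 := G.c0
  set f : ℕ → ℝ := fun j => μ.real (Fst M j) with hf
  have s1 : μ.real (⋃ k ∈ Finset.Ico M (2 * M), Cut k) ≤ ∑ j ∈ Finset.Ico M (2 * M), f j := by
    refine le_trans (measureReal_mono ?_ (measure_ne_top _ _)) (measureReal_biUnion_finset_le _ _)
    refine Set.iUnion₂_subset fun k hk => ?_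
    rw [Finset.mem_Ico] at hk
    refine (Cut_subset_Fst hk.1).trans ?_
    refine Set.biUnion_subset_biUnion_left fun j hj => ?_
    have hj := Finset.mem_Ico.1 hj
    exact Finset.mem_Ico.2 ⟨hj.1, by omega⟩
  have l16 : Real.log 4 ≤ Real.log M / 2 := by
    have : Real.log 16 ≤ Real.log M := Real.log_le_log (by norm_num) M0
    have e : Real.log 16 = 2 * Real.log 4 := by
      rw [show (16 : ℝ) = 4 ^ 2 by norm_num, Real.log_pow]; norm_num
    linarith
  have l4 : 0 < Real.log 4 := Real.log_pos (by norm_num)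
  have lM : 0 < Real.log M := by linarith
  have LM := B.L1 M hM
  have s2 : ∀ j ∈ Finset.Ico M (2 * M), c ^ 3 / 96 * Real.log M * f j ≤ 
      ∑ k ∈ Finset.Ico M (4 * M), μ.real (Fst M j ∩ Cut k) := by
    intro j hj
    rw [Finset.mem_Ico] at hj
    calc c ^ 3 / 96 * Real.log M * f j 
        ≤ c ^ 3 / 48 * (∑ k ∈ Finset.Ico (j + 4) (2 * j + 1), 1 / ((k : ℝ) - j)) * f j := by
          refine mul_le_mul_of_nonneg_right ?_ measureReal_nonneg
          have := harm_lower (j := j) (m := 2 * j + 1) (by omega)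
          have h2 : Real.log M ≤ Real.log (((2 * j + 1 : ℕ) : ℝ) - j) := by
            refine Real.log_le_log (by linarith) ?_
            have : (M : ℝ) ≤ j := by exact_mod_cast hj.1
            push_cast
            linarith
          have : Real.log M / 2 ≤ ∑ k ∈ Finset.Ico (j + 4) (2 * j + 1), 1 / ((k : ℝ) - j) := by
            linarith
          calc c ^ 3 / 96 * Real.log M = c ^ 3 / 48 * (Real.log M / 2) := by ring
            _ ≤ _ := by gcongr
      _ = ∑ k ∈ Finset.Ico (j + 4) (2 * j + 1), c ^ 3 / 48 * (1 / ((k : ℝ) - j)) * f j := by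
          rw [Finset.mul_sum, Finset.sum_mul]
      _ ≤ ∑ k ∈ Finset.Ico (j + 4) (2 * j + 1), μ.real (Fst M j ∩ Cut k) := by
          refine Finset.sum_le_sum fun k hk => ?_
          rw [Finset.mem_Ico] at hk
          have a1 := real_of_le (Fst_Cut_lower H G hμ (M := M) (j := j) (k := k) (by omega) 
            (by omega) (by omega))
          refine le_trans ?_ a1
          refine mul_le_mul_of_nonneg_right ?_ measureReal_nonneg
          have a2 := n3 G B (j := j) (k := k) (by omega) (by omega) (by omega)
          calc c ^ 3 / 48 * (1 / ((k : ℝ) - j)) = c ^ 3 / 3 * (1 / (16 * ((k : ℝ) - j))) := by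
                rw [← one_div_mul_one_div]; ring
            _ ≤ _ := by gcongr
      _ ≤ _ := by
          refine Finset.sum_le_sum_of_subset_of_nonneg ?_ fun _ _ _ => measureReal_nonneg
          intro k hk
          rw [Finset.mem_Ico] at *
          omega
  have s3 : ∑ j ∈ Finset.Ico M (2 * M), c ^ 3 / 96 * Real.log M * f j ≤ 6 / L M := by
    calc _ ≤ ∑ j ∈ Finset.Ico M (2 * M), ∑ k ∈ Finset.Ico M (4 * M), μ.real (Fst M j ∩ Cut k) :=
          Finset.sum_le_sum s2
      _ = ∑ k ∈ Finset.Ico M (4 * M), ∑ j ∈ Finset.Ico M (2 * M), μ.real (Fst M j ∩ Cut k) := 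
          Finset.sum_comm
      _ ≤ ∑ k ∈ Finset.Ico M (4 * M), 2 / (M * L M) := by
          refine Finset.sum_le_sum fun k hk => ?_
          rw [Finset.mem_Ico] at hk
          refine (sum_Fst_le M (2 * M) (measurableSet_Cut k)).trans ?_
          refine (measureReal_mono Set.inter_subset_right (measure_ne_top _ _)).trans ?_
          have a1 := Cut_upper H G hμ (k := k) (by omega) (by omega)
          have dT : 0 ≤ d k / TT d k := 
            div_nonneg (G.dpos k (by omega)).le (G.TT_pos (by omega)).le
          have a2 : μ.real (Cut k) ≤ d k / TT d k := ENNReal.toReal_le_of_le_ofReal dT a1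
          refine (a2.trans (n4u G B (by omega))).trans ?_
          have a3 := B.Lmono hM hk.1
          have : (M : ℝ) ≤ k := by exact_mod_cast hk.1
          gcongr
      _ = 6 / L M := by
          rw [Finset.sum_const, Nat.card_Ico, nsmul_eq_mul, Nat.cast_sub (by omega)]
          push_cast
          field_simp
          ring
  rw [← Finset.mul_sum] at s3
  refine s1.trans ?_
  rw [le_div_iff₀ (by positivity), le_div_iff₀ (by positivity)]
  rw [le_div_iff₀ (by positivity)] at s3
  nlinarith

end

end

section

lemma summable_aux {β : ℝ} (hβ : 1 < β) : 
    Summable fun m : ℕ => 1 / ((m : ℝ) * Real.log ((m : ℝ) + 2) ^ β) := by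
  have b0 : 0 ≤ β := by linarith
  have lp : ∀ m : ℕ, 0 < Real.log ((m : ℝ) + 2) := fun m => Real.log_pos (by
    have : (0 : ℝ) ≤ m := Nat.cast_nonneg m
    linarith)
  rw [← summable_condensed_iff_of_nonneg]
  · have h2 := (Real.summable_one_div_nat_rpow.2 hβ).mul_left (1 / (Real.log 2 ^ β))
    rw [← summable_nat_add_iff 1] at h2 ⊢
    refine Summable.of_nonneg_of_le (fun k => ?_) (fun k => ?_) h2
    · have := lp (2 ^ (k + 1))
      positivity
    · have l2 : 0 < Real.log 2 := Real.log_pos (by norm_num)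
      have h1 : ((k + 1 : ℕ) : ℝ) * Real.log 2 ≤ Real.log (((2 ^ (k + 1) : ℕ) : ℝ) + 2) := by
        rw [← Real.log_pow]
        refine Real.log_le_log (by positivity) ?_
        push_cast
        linarith
      have h3 : (((k + 1 : ℕ) : ℝ) * Real.log 2) ^ β ≤ Real.log (((2 ^ (k + 1) : ℕ) : ℝ) + 2) ^ β := 
        Real.rpow_le_rpow (by positivity) h1 b0
      rw [Real.mul_rpow (by positivity) l2.le] at h3
      have k1 : (0 : ℝ) < ((k + 1 : ℕ) : ℝ) := by positivity
      have h4 : 0 < ((k + 1 : ℕ) : ℝ) ^ β * Real.log 2 ^ β := by positivity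
      calc (2 : ℝ) ^ (k + 1) * (1 / (((2 ^ (k + 1) : ℕ) : ℝ) * 
            Real.log (((2 ^ (k + 1) : ℕ) : ℝ) + 2) ^ β)) 
          = 1 / Real.log (((2 ^ (k + 1) : ℕ) : ℝ) + 2) ^ β := by
            push_cast
            field_simp
        _ ≤ 1 / (((k + 1 : ℕ) : ℝ) ^ β * Real.log 2 ^ β) := one_div_le_one_div_of_le h4 h3
        _ = _ := by rw [← one_div_mul_one_div, mul_comm]
  · intro m
    have := lp m
    positivity
  · intro m n hm hmn
    have := lp m
    have hm0 : (0 : ℝ) < m := by exact_mod_cast hm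
    have hmn' : (m : ℝ) ≤ n := by exact_mod_cast hmn
    refine one_div_le_one_div_of_le (by positivity) ?_
    refine mul_le_mul hmn' (Real.rpow_le_rpow (lp m).le ?_ b0) (by positivity) (by positivity)
    exact Real.log_le_log (by linarith) (by linarith)

section
variable {q p1 p2 d : ℕ → ℝ} {K : ℕ} {c : ℝ}

theorem finite_case (H : WalkHyp q p1 p2) {β : ℝ} (hβ : 1 < β) (G : HarmHyp q p1 p2 d K c) 
    (B : LH (LL β) d K)
    {μ : Measure (ℕ → ℕ)} [IsProbabilityMeasure μ] {x : ℕ} 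
    (hμ : IsMarkovChain μ (transY q p1 p2) x) :
    ∀ᵐ ω ∂μ, {k : ℕ | ∀ n, ω n ≠ k}.Finite := by
  have b0 : 0 ≤ β := by linarith
  let E : ℕ → Set (ℕ → ℕ) := fun m => ⋃ k ∈ Finset.Ico (2 ^ m) (2 * 2 ^ m), Cut k
  have c0 := G.c0
  set C := 576 / c ^ 3 / Real.log 2 * 2 ^ β with hC
  have l2 : 0 < Real.log 2 := Real.log_pos (by norm_num)
  have C0 : 0 < C := by positivity
  have key : ∀ᶠ m : ℕ in atTop, μ.real (E m) ≤ C * (1 / ((m : ℝ) * Real.log ((m : ℝ) + 2) ^ β)) := by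
    filter_upwards [eventually_ge_atTop (K + x + 10)] with m hm
    have hlt : m < 2 ^ m := Nat.lt_two_pow_self
    have h1 := block_bound H G B hμ (M := 2 ^ m) (by omega) (by omega)
    refine h1.trans ?_
    have m0 : (10 : ℝ) ≤ m := by exact_mod_cast (by omega : 10 ≤ m)
    have e1 : Real.log ((2 ^ m : ℕ) : ℝ) = m * Real.log 2 := by
      push_cast; rw [Real.log_pow]
    have lm : 0 < Real.log ((m : ℝ) + 2) := Real.log_pos (by linarith)
    have h3 : Real.log ((m : ℝ) + 2) / 2 ≤ Real.log (m * Real.log 2) := by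
      have := Real.log_two_gt_d9
      have h6 : (m : ℝ) / 2 ≤ m * Real.log 2 := by nlinarith
      have h7 : ((m : ℝ) / 2) ^ 2 ≤ (m * Real.log 2) ^ 2 := by gcongr
      have h5 : (m : ℝ) + 2 ≤ (m * Real.log 2) ^ 2 := by nlinarith
      have := Real.log_le_log (by linarith) h5
      rw [Real.log_pow] at this
      push_cast at this
      linarith
    have h4 : (Real.log ((m : ℝ) + 2) / 2) ^ β ≤ LL β (2 ^ m) := by
      rw [LL, e1]
      exact Real.rpow_le_rpow (by linarith) h3 b0
    rw [Real.div_rpow lm.le (by norm_num)] at h4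
    rw [e1]
    calc 576 / c ^ 3 / (m * Real.log 2 * LL β (2 ^ m)) 
        ≤ 576 / c ^ 3 / (m * Real.log 2 * (Real.log ((m : ℝ) + 2) ^ β / 2 ^ β)) := by
          gcongr
      _ = _ := by rw [hC]; field_simp
  have hs : Summable fun m => μ.real (E m) := by
    obtain ⟨N, hN⟩ := eventually_atTop.1 key
    have h1 := (summable_aux hβ).mul_left C
    rw [← summable_nat_add_iff N] at h1 ⊢
    exact Summable.of_nonneg_of_le (fun _ => measureReal_nonneg) (fun k => hN _ (by omega)) h1
  have hs2 : ∑' m, μ (E m) ≠ ∞ := by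
    have : ∀ m, μ (E m) = ENNReal.ofReal (μ.real (E m)) := fun m => by
      exact (ofReal_measureReal (measure_ne_top μ _)).symm
    simp_rw [this]
    exact hs.tsum_ofReal_ne_top
  filter_upwards [ae_eventually_notMem hs2] with ω hω
  obtain ⟨N, hN⟩ := eventually_atTop.1 hω
  refine (Set.finite_Iio (2 ^ N)).subset fun k hk => ?_
  by_contra hlt
  have hk2 : 2 ^ N ≤ k := not_lt.1 hlt
  have k0 : k ≠ 0 := by have := Nat.one_le_two_pow (n := N); omega
  have a1 := Nat.pow_log_le_self 2 k0
  have a2 := Nat.lt_pow_succ_log_self (b := 2) (by norm_num) k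
  refine hN (Nat.log 2 k) ?_ ?_
  · exact Nat.le_log_of_pow_le (by norm_num) hk2
  · simp only [E, Set.mem_iUnion]
    exact ⟨k, Finset.mem_Ico.2 ⟨a1, by rw [pow_succ] at a2; omega⟩, hk⟩

end

end

section

section
variable {q p1 p2 d L : ℕ → ℝ} {K : ℕ} {c : ℝ}

/-- weighted sum -/
def SS (d : ℕ → ℝ) (M N : ℕ) : ℝ := ∑ k ∈ Finset.Ico M N, 1 / Real.log k * (d k / TT d k)

lemma second_moment (H : WalkHyp q p1 p2) (G : HarmHyp q p1 p2 d K c) (B : LH L d K)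
    {μ : Measure (ℕ → ℕ)} [IsProbabilityMeasure μ] {x : ℕ} 
    (hμ : IsMarkovChain μ (transY q p1 p2) x) {M N : ℕ} (hx : x < M) (hM : K + 3 ≤ M) :
    c ^ 3 / 3 * SS d M N ≤ (145 + 4 * SS d M N) * μ.real (⋃ k ∈ Finset.Ico M N, Cut k) := by
  classical
  have hK := B.hK
  have c0 := G.c0
  have log1 : ∀ k : ℕ, K ≤ k → 1 ≤ Real.log k := fun k hk => (B.L1 k hk).trans (B.Ll k hk)
  have dT : ∀ k : ℕ, K ≤ k → 0 ≤ d k / TT d k := fun k hk => 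
    div_nonneg (G.dpos k hk).le (G.TT_pos hk).le
  have w0 : ∀ k : ℕ, K ≤ k → 0 ≤ 1 / Real.log k := fun k hk => by
    have := log1 k hk
    positivity
  have w1 : ∀ k : ℕ, K ≤ k → 1 / Real.log k ≤ 1 := fun k hk => by
    have := log1 k hk
    rw [div_le_one (by linarith)]
    exact this
  have t0 : ∀ k : ℕ, K ≤ k → 0 ≤ 1 / Real.log k * (d k / TT d k) := fun k hk => 
    mul_nonneg (w0 k hk) (dT k hk)
  have S0 : 0 ≤ SS d M N := Finset.sum_nonneg fun k hk => 
    t0 k (by have := (Finset.mem_Ico.1 hk).1; omega)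
  have s1 : c ^ 3 / 3 * SS d M N ≤ ∑ k ∈ Finset.Ico M N, 1 / Real.log k * μ.real (Cut k) := by
    unfold SS
    rw [Finset.mul_sum]
    refine Finset.sum_le_sum fun k hk => ?_
    rw [Finset.mem_Ico] at hk
    have a1 := Cut_lower H G hμ (k := k) (by omega) (by omega)
    rw [← ENNReal.ofReal_mul (by positivity)] at a1
    have a2 := (ENNReal.ofReal_le_iff_le_toReal (measure_ne_top μ _)).1 a1
    have := mul_le_mul_of_nonneg_left a2 (w0 k (by omega))
    rw [Measure.real]
    linarith
  have s2 : ∑ k ∈ Finset.Ico M N, 1 / Real.log k * μ.real (Cut k) ≤ 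
      ∑ j ∈ Finset.Ico M N, ∑ k ∈ Finset.Ico j N, 1 / Real.log k * μ.real (Fst M j ∩ Cut k) := by
    rw [Finset.sum_Ico_Ico_comm]
    refine Finset.sum_le_sum fun k hk => ?_
    rw [Finset.mem_Ico] at hk
    rw [← Finset.mul_sum]
    refine mul_le_mul_of_nonneg_left ?_ (w0 k (by omega))
    refine le_trans (measureReal_mono ?_ (measure_ne_top _ _)) (measureReal_biUnion_finset_le _ _)
    intro ω hω
    have := Cut_subset_Fst hk.1 hω
    simp only [Set.mem_iUnion] at this ⊢
    obtain ⟨j, hj, hj2⟩ := this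
    exact ⟨j, hj, hj2, hω⟩
  have s3 : ∀ j ∈ Finset.Ico M N, 
      ∑ k ∈ Finset.Ico j N, 1 / Real.log k * μ.real (Fst M j ∩ Cut k) ≤ 
        (145 + 4 * SS d M N) * μ.real (Fst M j) := by
    intro j hj
    rw [Finset.mem_Ico] at hj
    have lj := log1 j (by omega)
    let g : ℕ → ℝ := fun k => (if k = j then 1 else 0) + 
      (if k ∈ Finset.Ico (j + 1) (j ^ 2) then 48 / Real.log j * (1 / ((k : ℝ) - j)) else 0) +
      4 * (1 / Real.log k * (d k / TT d k))
    have g1 : ∀ k ∈ Finset.Ico j N, 1 / Real.log k * μ.real (Fst M j ∩ Cut k) ≤ 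
        g k * μ.real (Fst M j) := by
      intro k hk
      rw [Finset.mem_Ico] at hk
      have i1 : (0 : ℝ) ≤ if k = j then 1 else 0 := by split_ifs <;> norm_num
      have i2 : (0 : ℝ) ≤ if k ∈ Finset.Ico (j + 1) (j ^ 2) then 
          48 / Real.log j * (1 / ((k : ℝ) - j)) else 0 := by
        have : (j : ℝ) ≤ k := by exact_mod_cast hk.1
        have : (0 : ℝ) ≤ k - j := by linarith
        split_ifs <;> positivity
      have i3 := t0 k (by omega)
      by_cases hkj : k = j
      · have : 1 ≤ g k := by
          simp only [g]
          rw [if_pos hkj] at i1 ⊢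
          linarith
        calc _ ≤ 1 * μ.real (Fst M j) := by
              refine mul_le_mul (w1 k (by omega)) 
                (measureReal_mono Set.inter_subset_left (measure_ne_top _ _)) measureReal_nonneg
                (by norm_num)
          _ ≤ _ := mul_le_mul_of_nonneg_right this measureReal_nonneg
      · have a1 := real_of_ge (rr_nonneg G (by omega) (by omega)) (Fst_Cut_upper H G hμ (M := M) 
          (j := j) (k := k) (by omega) (by omega) (by omega))
        have a2 : 1 / Real.log k * rr d j k ≤ g k := by
          by_cases hk2 : k ∈ Finset.Ico (j + 1) (j ^ 2)
          · have b1 := n1 G B (j := j) (k := k) (by omega) (by omega)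
            have b2 : Real.log j ≤ Real.log k := by
              refine Real.log_le_log ?_ (by exact_mod_cast hk.1)
              exact_mod_cast (by omega : 0 < j)
            have b3 : 1 / Real.log k ≤ 1 / Real.log j := one_div_le_one_div_of_le (by linarith) b2
            have b4 := mul_le_mul b3 b1 (rr_nonneg G (by omega) (by omega)) (by positivity)
            simp only [g]
            rw [if_pos hk2] at i2 ⊢
            have e : 1 / Real.log j * (48 / ((k : ℝ) - j)) = 
              48 / Real.log j * (1 / ((k : ℝ) - j)) := by ring
            linarith
          · have b1 := n2 G B (j := j) (k := k) (by omega) (by 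
              rw [Finset.mem_Ico] at hk2; omega)
            have b2 := mul_le_mul_of_nonneg_left b1 (w0 k (by omega))
            simp only [g]
            linarith
        calc _ ≤ 1 / Real.log k * (rr d j k * μ.real (Fst M j)) := 
              mul_le_mul_of_nonneg_left a1 (w0 k (by omega))
          _ = (1 / Real.log k * rr d j k) * μ.real (Fst M j) := by ring
          _ ≤ _ := mul_le_mul_of_nonneg_right a2 measureReal_nonneg
    refine (Finset.sum_le_sum g1).trans ?_
    rw [← Finset.sum_mul]
    refine mul_le_mul_of_nonneg_right ?_ measureReal_nonneg
    simp only [g]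
    rw [Finset.sum_add_distrib, Finset.sum_add_distrib, ← Finset.mul_sum]
    have h1 : ∑ k ∈ Finset.Ico j N, (if k = j then (1 : ℝ) else 0) ≤ 1 := by
      rw [Finset.sum_ite_eq']
      split_ifs <;> norm_num
    have h2 : ∑ k ∈ Finset.Ico j N, (if k ∈ Finset.Ico (j + 1) (j ^ 2) then 
          48 / Real.log j * (1 / ((k : ℝ) - j)) else 0) ≤ 144 := by
      rw [← Finset.sum_filter]
      calc _ ≤ ∑ k ∈ Finset.Ico (j + 1) (j ^ 2), 48 / Real.log j * (1 / ((k : ℝ) - j)) := by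
            refine Finset.sum_le_sum_of_subset_of_nonneg ?_ ?_
            · intro k hk
              exact (Finset.mem_filter.1 hk).2
            · intro k hk _
              have : ((j + 1 : ℕ) : ℝ) ≤ k := by exact_mod_cast (Finset.mem_Ico.1 hk).1
              push_cast at this
              have : (0 : ℝ) ≤ k - j := by linarith
              positivity
        _ = 48 / Real.log j * ∑ k ∈ Finset.Ico (j + 1) (j ^ 2), (1 / ((k : ℝ) - j)) := by
            rw [Finset.mul_sum]
        _ ≤ 48 / Real.log j * (1 + 2 * Real.log j) := by
            have j16 : 16 ≤ j := by omega
            have := harm_upper (j := j) (m := j ^ 2) (by nlinarith)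
            have j16' : (16 : ℝ) ≤ j := by exact_mod_cast j16
            have l2 : Real.log (((j ^ 2 : ℕ) : ℝ) - 1 - j) ≤ 2 * Real.log j := by
              have : 2 * Real.log j = Real.log ((j : ℝ) ^ 2) := by
                rw [Real.log_pow]; norm_num
              rw [this]
              push_cast
              refine Real.log_le_log ?_ ?_
              · nlinarith
              · linarith
            gcongr
            linarith
        _ ≤ 48 / Real.log j * (3 * Real.log j) := by gcongr; linarith
        _ = 144 := by field_simp; norm_num
    have h3 : ∑ k ∈ Finset.Ico j N, 1 / Real.log k * (d k / TT d k) ≤ SS d M N := by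
      refine Finset.sum_le_sum_of_subset_of_nonneg (Finset.Ico_subset_Ico hj.1 le_rfl) ?_
      intro k hk _
      exact t0 k (by have := (Finset.mem_Ico.1 hk).1; omega)
    linarith
  refine (s1.trans (s2.trans (Finset.sum_le_sum s3))).trans ?_
  rw [← Finset.mul_sum]
  refine mul_le_mul_of_nonneg_left ?_ (by positivity)
  have := sum_Fst_le (μ := μ) M N MeasurableSet.univ
  simp only [Set.inter_univ] at this
  refine this.trans (measureReal_mono ?_ (measure_ne_top _ _))
  exact Set.biUnion_mono (fun _ h => h) fun j _ => Set.inter_subset_left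

lemma logloglog_tele {m n : ℕ} (hm : 3 ≤ m) (h : m ≤ n) 
    (hl : ∀ k, m ≤ k → 1 ≤ Real.log (Real.log k)) :
    Real.log (Real.log (Real.log n)) - Real.log (Real.log (Real.log m)) ≤ 
      ∑ i ∈ Finset.Ico m n, 1 / (i * Real.log i * Real.log (Real.log i)) := by
  induction n, h using Nat.le_induction with
  | base => simp
  | succ n hn ih =>
    rw [Finset.sum_Ico_succ_top hn]
    have h1 := loglog_step (n := n) (by omega)
    have h2 := hl n hn
    have h3 := hl (n + 1) (by omega)
    have h4 := log_sub_le (x := Real.log (Real.log n)) 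
      (y := Real.log (Real.log ((n + 1 : ℕ) : ℝ))) (by linarith) (by linarith)
    have h5 := div_le_div_of_nonneg_right h1 (show 0 ≤ Real.log (Real.log n) by linarith)
    rw [div_div] at h5
    linarith

lemma SS_unbdd {β : ℝ} (hβ1 : β ≤ 1) (G : HarmHyp q p1 p2 d K c) 
    (B : LH (LL β) d K) : ∀ᶠ M in atTop, ∀ A : ℝ, ∃ N, A ≤ SS d M N := by
  obtain ⟨N0, hN0⟩ := eventually_atTop.1 (tendsto_loglog.eventually_ge_atTop 1)
  filter_upwards [eventually_ge_atTop (N0 + K)] with M hM A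
  have hK := B.hK
  have t := (Real.tendsto_log_atTop.comp tendsto_loglog).eventually_ge_atTop 
    (3 * A + Real.log (Real.log (Real.log M)))
  obtain ⟨N, h1, h2⟩ := (t.and (eventually_ge_atTop M)).exists
  refine ⟨N, ?_⟩
  have h3 := logloglog_tele (m := M) (n := N) (by omega) h2 (fun k hk => hN0 k (by omega))
  have h4 : (1 / 3) * ∑ i ∈ Finset.Ico M N, 1 / (i * Real.log i * Real.log (Real.log i)) ≤ 
      SS d M N := by
    rw [Finset.mul_sum]
    refine Finset.sum_le_sum fun k hk => ?_
    rw [Finset.mem_Ico] at hk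
    have a1 := n4l G B (k := k) (by omega)
    have a2 := hN0 k (by omega)
    have a3 := B.L1 k (by omega)
    have a4 := a3.trans (B.Ll k (by omega))
    have a5 : LL β k ≤ Real.log (Real.log k) := by
      unfold LL
      calc _ ≤ Real.log (Real.log k) ^ (1 : ℝ) := Real.rpow_le_rpow_of_exponent_le a2 hβ1
        _ = _ := Real.rpow_one _
    have k0 : (0 : ℝ) < k := by exact_mod_cast (by omega : 0 < k)
    calc 1 / 3 * (1 / (k * Real.log k * Real.log (Real.log k))) 
        = 1 / Real.log k * (1 / (3 * (k * Real.log (Real.log k)))) := by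
          have : Real.log (Real.log k) ≠ 0 := by linarith
          field_simp
      _ ≤ 1 / Real.log k * (1 / (3 * (k * LL β k))) := by gcongr
      _ ≤ _ := by gcongr
  simp only [Function.comp] at h1
  linarith

lemma exists_cut_lower (H : WalkHyp q p1 p2) {β : ℝ} (hβ1 : β ≤ 1) (G : HarmHyp q p1 p2 d K c) 
    (B : LH (LL β) d K)
    {μ : Measure (ℕ → ℕ)} [IsProbabilityMeasure μ] {x : ℕ} 
    (hμ : IsMarkovChain μ (transY q p1 p2) x) :
    ENNReal.ofReal (c ^ 3 / 15) ≤ μ {ω | {k : ℕ | ∀ n, ω n ≠ k}.Infinite} := by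
  let U : ℕ → Set (ℕ → ℕ) := fun M => ⋃ k, ⋃ (_ : M ≤ k), Cut k
  have hU : {ω : ℕ → ℕ | {k : ℕ | ∀ n, ω n ≠ k}.Infinite} = ⋂ M, U M := by
    ext ω
    simp only [Set.mem_iInter, U, Set.mem_iUnion]
    rw [Set.mem_ofPred_eq, Set.infinite_iff_exists_gt]
    constructor
    · intro h M
      obtain ⟨k, h1, h2⟩ := h M
      exact ⟨k, h2.le, h1⟩
    · intro h M
      obtain ⟨k, h1, h2⟩ := h (M + 1)
      exact ⟨k, h2, h1⟩
  have mU : ∀ M, MeasurableSet (U M) := fun M => 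
    MeasurableSet.iUnion fun k => MeasurableSet.iUnion fun _ => measurableSet_Cut k
  have aU : Antitone U := by
    intro M M' h ω hω
    simp only [U, Set.mem_iUnion] at hω ⊢
    obtain ⟨k, h1, h2⟩ := hω
    exact ⟨k, h.trans h1, h2⟩
  have ev : ∀ᶠ M in atTop, ENNReal.ofReal (c ^ 3 / 15) ≤ μ (U M) := by
    filter_upwards [SS_unbdd hβ1 G B, eventually_ge_atTop (x + 1 + K + 3)] with M h1 h2
    obtain ⟨N, hN⟩ := h1 145
    have h3 := second_moment H G B hμ (M := M) (N := N) (by omega) (by omega)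
    have c0 := G.c0
    set S := SS d M N
    set P := μ.real (⋃ k ∈ Finset.Ico M N, Cut k) with hP
    have P0 : 0 ≤ P := measureReal_nonneg
    have h4 : c ^ 3 / 15 ≤ P := by
      have : c ^ 3 / 3 * S ≤ (5 * P) * S := by nlinarith
      have := le_of_mul_le_mul_right this (by linarith)
      linarith
    calc ENNReal.ofReal (c ^ 3 / 15) ≤ ENNReal.ofReal P := ENNReal.ofReal_le_ofReal h4
      _ = μ (⋃ k ∈ Finset.Ico M N, Cut k) := ofReal_measureReal (measure_ne_top μ _)
      _ ≤ _ := by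
        refine measure_mono ?_
        refine Set.iUnion_mono fun k => ?_
        refine Set.iUnion_subset fun hk => ?_
        exact Set.subset_iUnion_of_subset (Finset.mem_Ico.1 hk).1 le_rfl
  obtain ⟨M0, hM0⟩ := eventually_atTop.1 ev
  rw [hU, aU.measure_iInter (fun M => (mU M).nullMeasurableSet) ⟨0, measure_ne_top _ _⟩]
  refine le_iInf fun M => ?_
  refine (hM0 (max M M0) (le_max_right _ _)).trans (measure_mono (aU (le_max_left _ _)))

end

end

section

/-- the event of infinitely many cutpoints -/
def InfCut : Set (ℕ → ℕ) := {ω | {k : ℕ | ∀ n, ω n ≠ k}.Infinite}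

lemma measurableSet_InfCut : MeasurableSet InfCut := by
  have hU : InfCut = ⋂ M : ℕ, ⋃ k : ℕ, ⋃ (_ : M ≤ k), Cut k := by
    ext ω
    simp only [Set.mem_iInter, Set.mem_iUnion]
    rw [InfCut, Set.mem_ofPred_eq, Set.infinite_iff_exists_gt]
    constructor
    · intro h M
      obtain ⟨k, h1, h2⟩ := h M
      exact ⟨k, h2.le, h1⟩
    · intro h M
      obtain ⟨k, h1, h2⟩ := h (M + 1)
      exact ⟨k, h2, h1⟩
  rw [hU]
  exact MeasurableSet.iInter fun M => 
    MeasurableSet.iUnion fun k => MeasurableSet.iUnion fun _ => measurableSet_Cut k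

lemma shift_InfCut (n : ℕ) : shiftP n ⁻¹' InfCut ⊆ InfCut := by
  intro ω hω
  have h : {k : ℕ | ∀ m, shiftP n ω m ≠ k}.Infinite := hω
  have h2 := h.sdiff ((Finset.range n).image ω).finite_toSet
  refine Set.Infinite.mono ?_ h2
  rintro k ⟨h3, h4⟩ m hm
  by_cases hmn : m < n
  · exact h4 (by simpa using ⟨m, hmn, hm⟩)
  · refine h3 (m - n) ?_
    simp only [shiftP]
    rw [show n + (m - n) = m by omega]
    exact hm

lemma cyl_lower {μ : Measure (ℕ → ℕ)} [IsProbabilityMeasure μ] {p : ℕ → ℕ → ℝ} {x : ℕ}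
    (hμ : IsMarkovChain μ p x) (c : ℝ≥0∞)
    (h : ∀ (i : ℕ) (ν : Measure (ℕ → ℕ)), IsProbabilityMeasure ν → IsMarkovChain ν p i → 
      c ≤ ν InfCut)
    {n : ℕ} {A : Set (ℕ → ℕ)} (hA : MeasurableSet A) (hd : DetBy n A) :
    c * μ A ≤ μ (A ∩ InfCut) := by
  have hm : ∀ i : ℕ, MeasurableSet {ω : ℕ → ℕ | ω n = i} := fun i => measurableSet_eqAt n i
  have key : ∀ C : Set (ℕ → ℕ), MeasurableSet C → μ C = ∑' i : ℕ, μ (C ∩ {ω | ω n = i}) := by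
    intro C hC
    rw [← measure_iUnion]
    · congr 1
      ext ω
      simp
    · intro i j hij
      rw [Function.onFun, Set.disjoint_left]
      rintro ω ⟨_, h1⟩ ⟨_, h2⟩
      exact hij (h1.symm.trans h2)
    · exact fun i => hC.inter (hm i)
  rw [key A hA, key _ (hA.inter measurableSet_InfCut), ← ENNReal.tsum_mul_left]
  refine ENNReal.tsum_le_tsum fun i => ?_
  have := markov_restart_ge hμ (n := n) (A := A ∩ {ω | ω n = i}) (hA.inter (hm i)) (by
    rintro ω ω' h1 ⟨h2, h3⟩
    refine ⟨hd ω ω' h1 h2, ?_⟩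
    have h4 : ω n = i := h3
    show ω' n = i
    rw [← h1 n le_rfl, h4]) i (fun ω hω => hω.2) measurableSet_InfCut c (h i)
  refine this.trans (measure_mono ?_)
  rintro ω ⟨⟨h1, h2⟩, h3⟩
  exact ⟨⟨h1, shift_InfCut n h3⟩, h2⟩

lemma zero_one {μ : Measure (ℕ → ℕ)} [IsProbabilityMeasure μ] {p : ℕ → ℕ → ℝ} {x : ℕ}
    (hμ : IsMarkovChain μ p x) (c : ℝ) (c0 : 0 < c)
    (h : ∀ (i : ℕ) (ν : Measure (ℕ → ℕ)), IsProbabilityMeasure ν → IsMarkovChain ν p i → 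
      ENNReal.ofReal c ≤ ν InfCut) : μ InfCut = 1 := by
  rw [← prob_compl_eq_zero_iff measurableSet_InfCut]
  have dens := Measure.MeasureDense.of_generateFrom_isSetAlgebra_finite μ 
    (isSetAlgebra_measurableCylinders (α := fun _ : ℕ => ℕ)) generateFrom_measurableCylinders.symm
  have mI := measurableSet_InfCut
  suffices hh : μ.real InfCutᶜ = 0 by
    rwa [measureReal_eq_zero_iff] at hh
  by_contra hne
  have pos : 0 < μ.real InfCutᶜ := lt_of_le_of_ne measureReal_nonneg (Ne.symm hne)
  set a := μ.real InfCutᶜ with ha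
  set ε := c * a / (2 * (1 + c)) with hε
  have ε0 : 0 < ε := by positivity
  obtain ⟨t, ht, hlt⟩ := dens.approx InfCutᶜ mI.compl (measure_ne_top _ _) ε ε0
  have mt := dens.measurable t ht
  obtain ⟨s, S, hS, hts⟩ := (mem_measurableCylinders _).1 ht
  have hdet : DetBy (s.sup id) t := by
    intro ω ω' h1 h2
    rw [hts, mem_cylinder] at h2 ⊢
    convert h2 using 1
    ext ⟨i, hi⟩
    exact (h1 i (Finset.le_sup (f := id) hi)).symm
  have h1 := cyl_lower hμ _ h mt hdet
  have h2 : μ.real (symmDiff InfCutᶜ t) < ε := by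
    rw [Measure.real, ← ENNReal.toReal_ofReal ε0.le]
    exact (ENNReal.toReal_lt_toReal (measure_ne_top _ _) ENNReal.ofReal_ne_top).2 hlt
  have h3 : c * μ.real t ≤ μ.real (t ∩ InfCut) := by
    have := ENNReal.toReal_mono (measure_ne_top _ _) h1
    rwa [ENNReal.toReal_mul, ENNReal.toReal_ofReal c0.le] at this
  have h4 : μ.real (t ∩ InfCut) ≤ μ.real (symmDiff InfCutᶜ t) := by
    refine measureReal_mono ?_
    rintro ω ⟨hω1, hω2⟩
    exact Or.inr ⟨hω1, fun hc => hc hω2⟩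
  have h5 : a ≤ μ.real t + μ.real (symmDiff InfCutᶜ t) := by
    refine le_trans (measureReal_mono ?_) (measureReal_union_le t _)
    intro ω hω
    by_cases ho : ω ∈ t
    · exact Or.inl ho
    · exact Or.inr (Or.inl ⟨hω, ho⟩)
  have h6 : ε * (1 + c) = c * a / 2 := by
    rw [hε]; field_simp
  have h7 : 0 < c * a := by positivity
  nlinarith

theorem cutpoints_Y_final
    (q p1 p2 : ℕ → ℝ)
    (hq : ∀ k, 2 ≤ k → 0 < q k) (hp1 : ∀ k, 2 ≤ k → 0 ≤ p1 k)
    (hp2 : ∀ k, 2 ≤ k → 0 < p2 k)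
    (hsum : ∀ k, 2 ≤ k → q k + p1 k + p2 k = 1)
    (μ : Measure (ℕ → ℕ)) [IsProbabilityMeasure μ]
    (hμ : IsMarkovChain μ (transY q p1 p2) 2)
    (a b : ℝ) (ha : 0 < a) (hb : 0 < b)
    (hCa : Tendsto (fun k => (p1 k + p2 k) / q k) atTop (𝓝 a))
    (hCb : Tendsto (fun k => p2 k / q k) atTop (𝓝 b))
    (β : ℝ) (hβ : 0 ≤ β)
    (hrho : (fun k => rho q p1 p2 k - (1 + 3 * rseq β k))
      =O[atTop] fun k => rseq β k ^ 2) :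
    (1 < β → μ {ω | {k : ℕ | ∀ n, ω n ≠ k}.Finite} = 1) ∧
    (β ≤ 1 → μ {ω | {k : ℕ | ∀ n, ω n ≠ k}.Infinite} = 1) := by
  have H : WalkHyp q p1 p2 := ⟨hq, hp1, hp2, hsum⟩
  obtain ⟨d, K, c, G, B⟩ := exists_d H a b ha hb hCa hCb β hβ hrho
  constructor
  · intro h1
    have h := finite_case H h1 G B hμ
    have e : {ω : ℕ → ℕ | {k : ℕ | ∀ n, ω n ≠ k}.Finite} =ᵐ[μ] Set.univ := by
      filter_upwards [h] with ω hω
      exact eq_true hω |>.trans (eq_true trivial).symm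
    rw [measure_congr e, measure_univ]
  · intro h1
    have c0 := G.c0
    exact zero_one hμ (c ^ 3 / 15) (by positivity) fun i ν hν hc => by
      haveI := hν
      exact exists_cut_lower H h1 G B hc

end

theorem cutpoints_Y_sharp_criterion
    (q p1 p2 : ℕ → ℝ)
    (hq : ∀ k, 2 ≤ k → 0 < q k) (hp1 : ∀ k, 2 ≤ k → 0 ≤ p1 k)
    (hp2 : ∀ k, 2 ≤ k → 0 < p2 k)
    (hsum : ∀ k, 2 ≤ k → q k + p1 k + p2 k = 1)
    (μ : Measure (ℕ → ℕ)) [IsProbabilityMeasure μ]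
    (hμ : IsMarkovChain μ (transY q p1 p2) 2)
    (a b : ℝ) (ha : 0 < a) (hb : 0 < b)
    (hCa : Tendsto (fun k => (p1 k + p2 k) / q k) atTop (𝓝 a))
    (hCb : Tendsto (fun k => p2 k / q k) atTop (𝓝 b))
    (β : ℝ) (hβ : 0 ≤ β)
    (hrho : (fun k => rho q p1 p2 k - (1 + 3 * rseq β k))
      =O[atTop] fun k => rseq β k ^ 2) :
    (1 < β → μ {ω | {k : ℕ | ∀ n, ω n ≠ k}.Finite} = 1) ∧
    (β ≤ 1 → μ {ω | {k : ℕ | ∀ n, ω n ≠ k}.Infinite} = 1) := by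
  exact cutpoints_Y_final q p1 p2 hq hp1 hp2 hsum μ hμ a b ha hb hCa hCb β hβ hrho

end
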